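/- arXiv:1512.02490 — 5 statements merged into one kernel-verified Lean document; each statement's English description precedes it below -/
import Mathlib

section
/- Let α ∈ (0,1)∪(1,∞) and let H be a finite-dimensional complex Hilbert space with dim H ≥ 2. There is no function f:(0,∞)→ℝ such that for all positive definite density operators A, B on H one has Σ_{a∈σ(A)} Σ_{b∈σ(B)} b·f(a/b)·tr(P_a Q_b) = tr((B^{(1−α)/(2α)} A B^{(1−α)/(2α)})^α), where σ(·) denotes the spectrum, P_a is the orthogonal projection onto the eigenspace of A corresponding to the eigenvalue a, and Q_b is the orthogonal projection onto the eigenspace of B corresponding to the eigenvalue b. (In particular, the quantum Rényi divergence quantity D'_α(A‖B) = tr((B^{(1−α)/(2α)} A B^{(1−α)/(2α)})^α) is not a quantum f-divergence.) -/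
open Matrix
open scoped ComplexOrder

/-- Apply a real function to (the eigenvalues of) a Hermitian matrix via the
spectral decomposition (functional calculus); junk value `0` otherwise. -/
noncomputable def matFun {n : ℕ} (h : ℝ → ℝ) (A : Matrix (Fin n) (Fin n) ℂ) :
    Matrix (Fin n) (Fin n) ℂ :=
  if hA : A.IsHermitian then hA.cfc h else 0

/-- The (real part of the) trace of a complex matrix. -/
noncomputable def retr {n : ℕ} (M : Matrix (Fin n) (Fin n) ℂ) : ℝ := M.trace.re

/-- Real power of a positive semidefinite matrix via the spectral decomposition. -/
noncomputable def rpowMat {n : ℕ} (A : Matrix (Fin n) (Fin n) ℂ) (r : ℝ) :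
    Matrix (Fin n) (Fin n) ℂ := matFun (fun t => t ^ r) A

/-- Density operators: positive semidefinite matrices of trace `1`. -/
def Density (n : ℕ) := {A : Matrix (Fin n) (Fin n) ℂ // A.PosSemidef ∧ A.trace = 1}

/-- `supp A ⊆ supp B`, i.e. the range of `A` is contained in the range of `B`. -/
def suppLE {n : ℕ} (A B : Matrix (Fin n) (Fin n) ℂ) : Prop :=
  LinearMap.range (Matrix.toLin' A) ≤ LinearMap.range (Matrix.toLin' B)

/-- `supp A ⟂ supp B`: the ranges of `A` and `B` are orthogonal. -/
def suppOrth {n : ℕ} (A B : Matrix (Fin n) (Fin n) ℂ) : Prop :=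
  ∀ x y : Fin n → ℂ, star (A.mulVec x) ⬝ᵥ B.mulVec y = 0

/-- The extension `f₀` of `f : (0,∞) → (0,∞)` to `[0,∞)` with `f₀ 0 = 0`. -/
noncomputable def extZero (f : ℝ → ℝ) : ℝ → ℝ := fun t => if 0 < t then f t else 0

/-- The generalized divergence `D'_{f,g}(A‖B) = tr g(f₀(B) A f₀(B))` (real-valued version,
used when `lim_{ε→0⁺} f(ε) = 0`). -/
noncomputable def Dfg {n : ℕ} (f g : ℝ → ℝ) (A B : Matrix (Fin n) (Fin n) ℂ) : ℝ :=
  retr (matFun g (matFun (extZero f) B * A * matFun (extZero f) B))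

open scoped Classical in
/-- The generalized divergence `D'_{f,g}(A‖B)`: equal to `tr g(f₀(B) A f₀(B))` if
`supp A ⊆ supp B` and `∞` otherwise (used when `lim_{ε→0⁺} f(ε) = ∞`). -/
noncomputable def DfgE {n : ℕ} (f g : ℝ → ℝ) (A B : Matrix (Fin n) (Fin n) ℂ) : EReal :=
  if suppLE A B then ((Dfg f g A B : ℝ) : EReal) else ⊤

open scoped Classical in
/-- The quantum Rényi divergence `D_α(A‖B)` of density operators `A, B`
(with the convention `tr A = 1`), with values in the extended reals. -/
noncomputable def Dalpha {n : ℕ} (α : ℝ) (A B : Matrix (Fin n) (Fin n) ℂ) : EReal :=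
  if (α < 1 ∧ ¬ suppOrth A B) ∨ (1 < α ∧ suppLE A B) then
    (((α - 1)⁻¹ * Real.log (retr (rpowMat
      (rpowMat B ((1 - α) / (2 * α)) * A * rpowMat B ((1 - α) / (2 * α))) α)) : ℝ) : EReal)
  else ⊤

/-- The quantum Rényi divergence on the cone of positive definite matrices
(a finite real number there). -/
noncomputable def DalphaPD {n : ℕ} (α : ℝ) (A B : Matrix (Fin n) (Fin n) ℂ) : ℝ :=
  (α - 1)⁻¹ * Real.log ((retr A)⁻¹ * retr (rpowMat
    (rpowMat B ((1 - α) / (2 * α)) * A * rpowMat B ((1 - α) / (2 * α))) α))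

/-- Rank-one (orthogonal) projections: `P = x ⊗ x` for a unit vector `x`. -/
def IsRankOneProj {n : ℕ} (P : Matrix (Fin n) (Fin n) ℂ) : Prop :=
  ∃ x : Fin n → ℂ, star x ⬝ᵥ x = 1 ∧ P = Matrix.vecMulVec x (star x)

open scoped Classical in
/-- The spectrum of a Hermitian matrix as a finite set of reals. -/
noncomputable def specSet {n : ℕ} (A : Matrix (Fin n) (Fin n) ℂ) : Finset ℝ :=
  if hA : A.IsHermitian then Finset.image hA.eigenvalues Finset.univ else ∅

/-- The orthogonal (spectral) projection onto the eigenspace of a Hermitian matrix `A`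
corresponding to the eigenvalue `a`, obtained by applying the indicator function of `{a}`
to `A` via the spectral decomposition. -/
noncomputable def eigProj {n : ℕ} (A : Matrix (Fin n) (Fin n) ℂ) (a : ℝ) :
    Matrix (Fin n) (Fin n) ℂ :=
  matFun (fun t => if t = a then 1 else 0) A

section Hyperbolic

lemma hasDerivAt_cosh_mul (a x : ℝ) :
    HasDerivAt (fun x => Real.cosh (a * x)) (a * Real.sinh (a * x)) x := by
  have := ((hasDerivAt_id x).const_mul a).cosh
  simpa [mul_comm] using this

lemma hasDerivAt_sinh_mul (a x : ℝ) :
    HasDerivAt (fun x => Real.sinh (a * x)) (a * Real.cosh (a * x)) x := by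
  have := ((hasDerivAt_id x).const_mul a).sinh
  simpa [mul_comm] using this

lemma cross_sinh_cosh_ne_zero {a : ℝ} (ha : 0 < a) (ha1 : a ≠ 1) {x : ℝ} (hx : 0 < x) :
    a * Real.cosh (a * x) * Real.sinh x - Real.sinh (a * x) * Real.cosh x ≠ 0 := by
  intro h0
  obtain ⟨c, hc, hc'⟩ := exists_hasDerivAt_eq_zero
    (f := fun x => a * Real.cosh (a * x) * Real.sinh x - Real.sinh (a * x) * Real.cosh x)
    (f' := fun x => (a ^ 2 - 1) * (Real.sinh (a * x) * Real.sinh x)) hx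
    (by fun_prop) (by simp [h0]) (fun y _ => by
      have h1 := (((hasDerivAt_cosh_mul a y).const_mul a).mul (Real.hasDerivAt_sinh y)).sub
        ((hasDerivAt_sinh_mul a y).mul (Real.hasDerivAt_cosh y))
      exact h1.congr_deriv (by ring))
  have h1 : 0 < Real.sinh (a * c) := Real.sinh_pos_iff.2 (mul_pos ha hc.1)
  have h2 : 0 < Real.sinh c := Real.sinh_pos_iff.2 hc.1
  have h3 : a ^ 2 - 1 ≠ 0 := fun h => ha1 (by nlinarith [mul_self_nonneg (a - 1)])
  exact mul_ne_zero h3 (mul_pos h1 h2).ne' hc'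

/-- A relation `cosh (a x) = p cosh x + q` with `a ≠ 1` has at most two solutions `x ≥ 0`. -/
lemma cosh_mul_not_affine {a : ℝ} (ha : 0 < a) (ha1 : a ≠ 1) {p q u w v : ℝ}
    (hu : 0 ≤ u) (huw : u < w) (hwv : w < v)
    (h1 : Real.cosh (a * u) = p * Real.cosh u + q)
    (h2 : Real.cosh (a * w) = p * Real.cosh w + q)
    (h3 : Real.cosh (a * v) = p * Real.cosh v + q) : False := by
  have hd : ∀ y, HasDerivAt (fun x => Real.cosh (a * x) - p * Real.cosh x)
      (a * Real.sinh (a * y) - p * Real.sinh y) y := fun y =>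
    (hasDerivAt_cosh_mul a y).sub ((Real.hasDerivAt_cosh y).const_mul p)
  obtain ⟨ξ, hξ, hξ'⟩ := exists_hasDerivAt_eq_zero huw (by fun_prop)
    (by simp only [h1, h2]; ring) (fun y _ => hd y)
  obtain ⟨η, hη, hη'⟩ := exists_hasDerivAt_eq_zero hwv (by fun_prop)
    (by simp only [h2, h3]; ring) (fun y _ => hd y)
  have hξ0 : 0 < ξ := hu.trans_lt hξ.1
  have hξη : ξ < η := hξ.2.trans hη.1
  have hs : ∀ y, 0 < y → 0 < Real.sinh y := fun y hy => Real.sinh_pos_iff.2 hy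
  have hratio : ∀ y, 0 < y → a * Real.sinh (a * y) - p * Real.sinh y = 0 →
      Real.sinh (a * y) / Real.sinh y = p / a := fun y hy h => by
    have := (hs y hy).ne'
    field_simp
    linarith
  obtain ⟨c, hc, hc'⟩ := exists_hasDerivAt_eq_zero
    (f := fun x => Real.sinh (a * x) / Real.sinh x) hξη
    (ContinuousOn.div (by fun_prop) (by fun_prop)
      (fun y hy => (hs y (hξ0.trans_le hy.1)).ne'))
    ((hratio ξ hξ0 hξ').trans (hratio η (hξ0.trans hξη) hη').symm)
    (fun y hy => (hasDerivAt_sinh_mul a y).div (Real.hasDerivAt_sinh y)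
      (hs y (hξ0.trans hy.1)).ne')
  have hc0 : 0 < c := hξ0.trans hc.1
  rw [div_eq_zero_iff] at hc'
  rcases hc' with h | h
  · exact cross_sinh_cosh_ne_zero ha ha1 hc0 h
  · exact (pow_pos (hs c hc0) 2).ne' h

lemma abs_eq_abs_of_cosh_midpoint {a : ℝ} (ha : 0 < a) (ha1 : a ≠ 1) {u v w : ℝ}
    (h : Real.cosh u + Real.cosh v = 2 * Real.cosh w)
    (h' : Real.cosh (a * u) + Real.cosh (a * v) = 2 * Real.cosh (a * w)) : |u| = |v| := by
  wlog huv : |u| ≤ |v| generalizing u v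
  · exact (this (by linarith) (by linarith) (le_of_not_ge huv)).symm
  by_contra hne
  have hlt := lt_of_le_of_ne huv hne
  have hlt' := Real.cosh_lt_cosh.2 hlt
  have huw : |u| < |w| := Real.cosh_lt_cosh.1 (by linarith)
  have hwv : |w| < |v| := Real.cosh_lt_cosh.1 (by linarith)
  have habs : ∀ y, Real.cosh (a * |y|) = Real.cosh (a * y) := fun y => by
    rw [← Real.cosh_abs (a * y), abs_mul, abs_of_pos ha]
  have hne' : Real.cosh v - Real.cosh u ≠ 0 := by linarith
  obtain ⟨p, hp⟩ : ∃ p, p * (Real.cosh v - Real.cosh u) = Real.cosh (a * v) - Real.cosh (a * u) :=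
    ⟨_, div_mul_cancel₀ _ hne'⟩
  refine cosh_mul_not_affine (p := p) (q := Real.cosh (a * u) - p * Real.cosh u)
    ha ha1 (abs_nonneg u) huw hwv ?_ ?_ ?_
  all_goals rw [habs, Real.cosh_abs]
  · ring
  · linear_combination (-1/2) * h' + (p/2) * h - (1/2) * hp
  · linear_combination - hp

lemma add_rpow_eq_cosh {x y : ℝ} (hx : 0 < x) (hy : 0 < y) (r : ℝ) :
    x ^ r + y ^ r = 2 * (x * y) ^ (r / 2) * Real.cosh (r * ((Real.log x - Real.log y) / 2)) := by
  rw [Real.cosh_eq, Real.rpow_def_of_pos hx, Real.rpow_def_of_pos hy,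
    Real.rpow_def_of_pos (mul_pos hx hy), Real.log_mul hx.ne' hy.ne']
  have : ∀ A B C : ℝ, 2 * A * ((B + C) / 2) = A * B + A * C := fun A B C => by ring
  rw [this, ← Real.exp_add, ← Real.exp_add]
  ring_nf

/-- Three pairs of positive reals with the same product, the sums of the third pair being the
averages of those of the first two both for exponent `1` and for exponent `a`: then the first two
pairs coincide. -/
lemma pair_eq_of_midpoint {a : ℝ} (ha : 0 < a) (ha1 : a ≠ 1) {x₁ x₂ y₁ y₂ z₁ z₂ : ℝ}
    (hx₁ : 0 < x₁) (hx₂ : 0 < x₂) (hy₁ : 0 < y₁) (hy₂ : 0 < y₂) (hz₁ : 0 < z₁) (hz₂ : 0 < z₂)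
    (hxy : x₁ * x₂ = y₁ * y₂) (hxz : x₁ * x₂ = z₁ * z₂)
    (h : (x₁ + x₂) + (y₁ + y₂) = 2 * (z₁ + z₂))
    (h' : (x₁ ^ a + x₂ ^ a) + (y₁ ^ a + y₂ ^ a) = 2 * (z₁ ^ a + z₂ ^ a)) :
    x₁ = y₁ ∨ x₁ = y₂ := by
  have key : ∀ r : ℝ, (x₁ ^ r + x₂ ^ r) + (y₁ ^ r + y₂ ^ r) = 2 * (z₁ ^ r + z₂ ^ r) →
      Real.cosh (r * ((Real.log x₁ - Real.log x₂) / 2)) +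
        Real.cosh (r * ((Real.log y₁ - Real.log y₂) / 2)) =
        2 * Real.cosh (r * ((Real.log z₁ - Real.log z₂) / 2)) := fun r hr => by
    rw [add_rpow_eq_cosh hx₁ hx₂, add_rpow_eq_cosh hy₁ hy₂, add_rpow_eq_cosh hz₁ hz₂, ← hxy,
      ← hxz] at hr
    have : (0 : ℝ) < (x₁ * x₂) ^ (r / 2) := Real.rpow_pos_of_pos (mul_pos hx₁ hx₂) _
    apply mul_left_cancel₀ (mul_pos two_pos this).ne'
    linear_combination hr
  have h1 := key 1 (by simpa using h)
  simp only [one_mul] at h1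
  have hlog : Real.log x₁ + Real.log x₂ = Real.log y₁ + Real.log y₂ := by
    rw [← Real.log_mul hx₁.ne' hx₂.ne', ← Real.log_mul hy₁.ne' hy₂.ne', hxy]
  rcases abs_eq_abs.1 (abs_eq_abs_of_cosh_midpoint ha ha1 h1 (key a h')) with hc | hc
  · exact Or.inl (Real.log_injOn_pos hx₁ hy₁ (by linarith))
  · exact Or.inr (Real.log_injOn_pos hx₁ hy₂ (by linarith))

end Hyperbolic

section SpectralCalculus

variable {n : ℕ}

/-- Functional calculus of a matrix given in diagonalized form. -/
lemma matFun_conj_diagonal (h : ℝ → ℝ) {U : Matrix (Fin n) (Fin n) ℂ} (hU : Uᴴ * U = 1)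
    (d : Fin n → ℝ) :
    matFun h (U * diagonal (fun i => (d i : ℂ)) * Uᴴ) =
      U * diagonal (fun i => (h (d i) : ℂ)) * Uᴴ := by
  have hU' : U * Uᴴ = 1 := mul_eq_one_comm.1 hU
  let φ : (Fin n → ℝ) →ₐ[ℝ] Matrix (Fin n) (Fin n) ℂ := AlgHom.ofLinearMap
    { toFun := fun v => U * diagonal (fun i => (v i : ℂ)) * Uᴴ
      map_add' := fun v w => by
        simp [← diagonal_add, mul_add, add_mul]
      map_smul' := fun r v => by
        have : diagonal (fun i => ((r • v) i : ℂ)) = r • diagonal (fun i => (v i : ℂ)) := by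
          ext i j; by_cases hij : i = j <;> simp [diagonal, hij]
        rw [this, mul_smul_comm, smul_mul_assoc, RingHom.id_apply] }
    (by simp [hU'])
    (fun v w => by
      have : diagonal (fun i => ((v * w) i : ℂ)) =
          diagonal (fun i => (v i : ℂ)) * diagonal (fun i => (w i : ℂ)) := by
        simp
      simp only [LinearMap.coe_mk, AddHom.coe_mk, this]
      simp only [mul_assoc]
      rw [← mul_assoc Uᴴ U, hU, one_mul])
  have hφ : ∀ v : Fin n → ℝ, φ v = U * diagonal (fun i => (v i : ℂ)) * Uᴴ := fun _ => rfl
  have hherm : (φ d).IsHermitian := by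
    rw [hφ]
    exact isHermitian_mul_mul_conjTranspose U
      (isHermitian_diagonal_of_self_adjoint _ (by ext i; simp))
  rw [← hφ, ← hφ (fun i => h (d i)), matFun, dif_pos hherm, ← hherm.cfc_eq]
  classical
  let s : Finset ℝ := Finset.univ.image hherm.eigenvalues ∪ Finset.univ.image d
  let q : Polynomial ℝ := Lagrange.interpolate s id h
  have hq : ∀ x ∈ s, q.eval x = h x := fun x hx => by
    exact Lagrange.eval_interpolate_at_node (v := id) h (Set.injOn_id _) hx
  have hcongr : cfc h (φ d) = cfc q.eval (φ d) := cfc_congr fun x hx => by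
    rw [hherm.spectrum_real_eq_range_eigenvalues] at hx
    obtain ⟨i, rfl⟩ := hx
    exact (hq _ (by simp [s])).symm
  rw [hcongr, cfc_polynomial q (φ d) hherm.isSelfAdjoint, Polynomial.aeval_algHom_apply]
  congr 1
  ext i
  have := Polynomial.aeval_algHom_apply (Pi.evalAlgHom ℝ (fun _ : Fin n => ℝ) i) d q
  simp only [Pi.evalAlgHom_apply] at this
  rw [← this, ← hq _ (by simp [s] : d i ∈ s), Polynomial.coe_aeval_eq_eval]

lemma matFun_diagonal (h : ℝ → ℝ) (d : Fin n → ℝ) :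
    matFun h (diagonal (fun i => (d i : ℂ))) = diagonal (fun i => (h (d i) : ℂ)) := by
  simpa using matFun_conj_diagonal h (U := 1) (by simp) d

lemma retr_matFun (h : ℝ → ℝ) {M : Matrix (Fin n) (Fin n) ℂ} (hM : M.IsHermitian) :
    retr (matFun h M) = ∑ i, h (hM.eigenvalues i) := by
  rw [retr, matFun, dif_pos hM, IsHermitian.cfc, Unitary.conjStarAlgAut_apply, trace_mul_comm,
    ← mul_assoc]
  simp [trace_diagonal]

lemma specSet_conj_diagonal {U : Matrix (Fin n) (Fin n) ℂ} (hU : Uᴴ * U = 1)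
    (d : Fin n → ℝ) :
    specSet (U * diagonal (fun i => (d i : ℂ)) * Uᴴ) = Finset.univ.image d := by
  have hherm : (U * diagonal (fun i => (d i : ℂ)) * Uᴴ).IsHermitian :=
    isHermitian_mul_mul_conjTranspose U
      (isHermitian_diagonal_of_self_adjoint _ (by ext i; simp))
  have hroots : ((U * diagonal (fun i => (d i : ℂ)) * Uᴴ).charpoly).roots =
      Multiset.map (fun i => (d i : ℂ)) Finset.univ.val := by
    rw [charpoly_mul_comm, ← mul_assoc, hU, one_mul, charpoly_diagonal,
      Polynomial.roots_prod _ _ (Finset.prod_ne_zero_iff.2 fun i _ => Polynomial.X_sub_C_ne_zero _)]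
    simp [Multiset.bind_singleton]
  rw [hherm.roots_charpoly_eq_eigenvalues] at hroots
  have hmem : ∀ z : ℂ, (∃ i, (hherm.eigenvalues i : ℂ) = z) ↔ ∃ i, (d i : ℂ) = z := fun z => by
    simpa using congrArg (z ∈ ·) hroots
  rw [specSet, dif_pos hherm]
  ext x
  simpa using hmem (x : ℂ)

/-- The spectral formula for the `f`-divergence in terms of the overlaps of the eigenvectors. -/
lemma spectral_sum_eq (F : ℝ → ℝ → ℝ) {U : Matrix (Fin n) (Fin n) ℂ} (hU : Uᴴ * U = 1)
    (d e : Fin n → ℝ) :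
    (∑ a ∈ specSet (U * diagonal (fun i => (d i : ℂ)) * Uᴴ),
      ∑ b ∈ specSet (diagonal (fun i => (e i : ℂ))), F a b *
        retr (eigProj (U * diagonal (fun i => (d i : ℂ)) * Uᴴ) a *
          eigProj (diagonal (fun i => (e i : ℂ))) b)) =
      ∑ i, ∑ j, F (d i) (e j) * Complex.normSq (U j i) := by
  classical
  have hspec := specSet_conj_diagonal (U := 1) (by simp) e
  simp only [one_mul, conjTranspose_one, mul_one] at hspec
  have htr : ∀ a b, retr (eigProj (U * diagonal (fun i => (d i : ℂ)) * Uᴴ) a *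
      eigProj (diagonal (fun i => (e i : ℂ))) b) =
      ∑ i, ∑ j, (if d i = a then 1 else 0) * (if e j = b then 1 else 0) *
        Complex.normSq (U j i) := fun a b => by
    rw [eigProj, eigProj, matFun_conj_diagonal _ hU, matFun_diagonal, retr, trace, Complex.re_sum,
      Finset.sum_comm]
    refine Finset.sum_congr rfl fun j _ => ?_
    rw [diag_apply, mul_diagonal, mul_apply, Finset.sum_mul, Complex.re_sum]
    refine Finset.sum_congr rfl fun i _ => ?_
    rw [mul_diagonal, conjTranspose_apply]
    by_cases h1 : d i = a <;> by_cases h2 : e j = b <;>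
      simp [h1, h2, Complex.normSq_apply]
  simp only [specSet_conj_diagonal hU, hspec, htr, Finset.mul_sum]
  calc _ = ∑ i, ∑ j, ∑ a ∈ Finset.univ.image d, ∑ b ∈ Finset.univ.image e, F a b *
        ((if d i = a then 1 else 0) * (if e j = b then 1 else 0) * Complex.normSq (U j i)) := by
        rw [Finset.sum_congr rfl fun a _ => Finset.sum_comm, Finset.sum_comm]
        refine Finset.sum_congr rfl fun i _ => ?_
        rw [Finset.sum_congr rfl fun a _ => Finset.sum_comm, Finset.sum_comm]
    _ = _ := by
      refine Finset.sum_congr rfl fun i _ => Finset.sum_congr rfl fun j _ => ?_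
      rw [Finset.sum_eq_single_of_mem (d i) (by simp), Finset.sum_eq_single_of_mem (e j) (by simp)]
      · simp
      · intro b _ hb
        simp [hb.symm]
      · intro a _ ha
        simp [ha.symm]

/-- Trace of the functional calculus of a Hermitian matrix consisting of a `2 × 2` block and a
diagonal block. -/
lemma exists_retr_matFun_block {m : ℕ} {M : Matrix (Fin (2 + m)) (Fin (2 + m)) ℂ}
    (hM : M.IsHermitian) {N : Matrix (Fin 2) (Fin 2) ℂ} (d : Fin m → ℝ)
    (hMN : reindex finSumFinEquiv.symm finSumFinEquiv.symm M =
      fromBlocks N 0 0 (diagonal (fun i => (d i : ℂ)))) :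
    ∃ x y : ℝ, (x : ℂ) + y = N.trace ∧ (x : ℂ) * y = N.det ∧
      ∀ h : ℝ → ℝ, retr (matFun h M) = h x + h y + ∑ i, h (d i) := by
  have hN : N.IsHermitian := by
    have : (fromBlocks N 0 0 (diagonal (fun i => (d i : ℂ)))).IsHermitian :=
      hMN ▸ hM.submatrix _
    exact (isHermitian_fromBlocks_iff.1 this).1
  refine ⟨hN.eigenvalues 0, hN.eigenvalues 1, ?_, ?_, fun h => ?_⟩
  · rw [hN.trace_eq_sum_eigenvalues, Fin.sum_univ_two]; rfl
  · rw [hN.det_eq_prod_eigenvalues, Fin.prod_univ_two]; rfl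
  have hroots : M.charpoly.roots =
      Multiset.map (fun i => (hN.eigenvalues i : ℂ)) Finset.univ.val +
        Multiset.map (fun i => (d i : ℂ)) Finset.univ.val := by
    rw [← charpoly_reindex finSumFinEquiv.symm, hMN, charpoly_fromBlocks_zero₁₂,
      Polynomial.roots_mul (mul_ne_zero (charpoly_monic _).ne_zero (charpoly_monic _).ne_zero),
      hN.roots_charpoly_eq_eigenvalues, charpoly_diagonal (n := Fin m),
      Polynomial.roots_prod _ _ (Finset.prod_ne_zero_iff.2 fun i _ => Polynomial.X_sub_C_ne_zero _)]
    simp [Multiset.bind_singleton]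
  rw [hM.roots_charpoly_eq_eigenvalues] at hroots
  have := congrArg (fun s : Multiset ℂ => (s.map fun z => h z.re).sum) hroots
  simp only [Multiset.map_map, Multiset.map_add, Multiset.sum_add, Function.comp_def,
    Complex.ofReal_re, Complex.coe_algebraMap] at this
  rw [retr_matFun h hM]
  simpa [Finset.sum, Fin.sum_univ_two] using this

end SpectralCalculus

section SqrtPerm

variable {n : ℕ}

/-- For an involution `σ`, a unitary square root of the permutation matrix of `σ`. -/
noncomputable def sqrtPerm (σ : Equiv.Perm (Fin n)) : Matrix (Fin n) (Fin n) ℂ :=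
  ((1 + Complex.I) / 2) • 1 + ((1 - Complex.I) / 2) • σ.permMatrix ℂ

lemma permMatrix_conjTranspose_of_involution {σ : Equiv.Perm (Fin n)} (hσ : σ * σ = 1) :
    (σ.permMatrix ℂ)ᴴ = σ.permMatrix ℂ := by
  rw [conjTranspose_permMatrix, inv_eq_of_mul_eq_one_left hσ]

lemma permMatrix_mul_self_of_involution {σ : Equiv.Perm (Fin n)} (hσ : σ * σ = 1) :
    σ.permMatrix ℂ * σ.permMatrix ℂ = 1 := by
  rw [← permMatrix_mul, hσ, permMatrix_one]

lemma sqrtPerm_conjTranspose {σ : Equiv.Perm (Fin n)} (hσ : σ * σ = 1) :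
    (sqrtPerm σ)ᴴ = ((1 - Complex.I) / 2) • 1 + ((1 + Complex.I) / 2) • σ.permMatrix ℂ := by
  simp [sqrtPerm, permMatrix_conjTranspose_of_involution hσ, sub_eq_add_neg]

lemma sqrtPerm_unitary {σ : Equiv.Perm (Fin n)} (hσ : σ * σ = 1) :
    (sqrtPerm σ)ᴴ * sqrtPerm σ = 1 := by
  rw [sqrtPerm_conjTranspose hσ, sqrtPerm]
  simp only [add_mul, mul_add, smul_mul_assoc, mul_smul_comm, one_mul, mul_one,
    permMatrix_mul_self_of_involution hσ]
  match_scalars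
  · linear_combination (-1 / 2) * Complex.I_sq
  · linear_combination (1 / 2) * Complex.I_sq

lemma normSq_sqrtPerm (σ : Equiv.Perm (Fin n)) (i j : Fin n) :
    Complex.normSq (sqrtPerm σ i j) =
      (Complex.normSq ((1 : Matrix (Fin n) (Fin n) ℂ) i j) +
        Complex.normSq (σ.permMatrix ℂ i j)) / 2 := by
  have hS : σ.permMatrix ℂ i j = if σ i = j then 1 else 0 := by
    simp [Equiv.Perm.permMatrix, PEquiv.toMatrix_apply]
  rw [sqrtPerm, Matrix.add_apply, Matrix.smul_apply, Matrix.smul_apply, hS, one_apply]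
  split_ifs <;> simp [Complex.normSq_apply] <;> norm_num

lemma permMatrix_conj_diagonal {σ : Equiv.Perm (Fin n)} (hσ : σ * σ = 1) (d : Fin n → ℂ) :
    σ.permMatrix ℂ * diagonal d * (σ.permMatrix ℂ)ᴴ = diagonal (d ∘ σ) := by
  rw [permMatrix_conjTranspose_of_involution hσ]
  have : σ.permMatrix ℂ * diagonal d = diagonal (d ∘ σ) * σ.permMatrix ℂ := by
    ext i j
    by_cases h : σ i = j <;> simp [Equiv.Perm.permMatrix, PEquiv.toMatrix_apply, h]
  rw [this, mul_assoc, permMatrix_mul_self_of_involution hσ, mul_one]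

lemma sqrtPerm_conj_diagonal {σ : Equiv.Perm (Fin n)} (hσ : σ * σ = 1) (d : Fin n → ℂ) :
    sqrtPerm σ * diagonal d * (sqrtPerm σ)ᴴ =
      (1 / 2 : ℂ) • (diagonal d + diagonal (d ∘ σ)) +
        (Complex.I / 2) • (diagonal d * σ.permMatrix ℂ - σ.permMatrix ℂ * diagonal d) := by
  rw [← permMatrix_conj_diagonal hσ, permMatrix_conjTranspose_of_involution hσ,
    sqrtPerm_conjTranspose hσ, sqrtPerm]
  simp only [add_mul, mul_add, smul_mul_assoc, mul_smul_comm, one_mul, mul_one, smul_add, smul_sub]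
  match_scalars <;> ring_nf <;> simp [Complex.I_sq] <;> ring

end SqrtPerm

lemma retr_matFun_conj_perm_diagonal {n : ℕ} (h : ℝ → ℝ) {σ : Equiv.Perm (Fin n)}
    (hσ : σ * σ = 1) (x d : Fin n → ℝ) :
    retr (matFun h (diagonal (fun i => (x i : ℂ)) *
      (σ.permMatrix ℂ * diagonal (fun i => (d i : ℂ)) * (σ.permMatrix ℂ)ᴴ) *
        diagonal (fun i => (x i : ℂ)))) = ∑ i, h (x i * d (σ i) * x i) := by
  have : diagonal (fun i => (x i : ℂ)) *
      (σ.permMatrix ℂ * diagonal (fun i => (d i : ℂ)) * (σ.permMatrix ℂ)ᴴ) *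
        diagonal (fun i => (x i : ℂ)) = diagonal (fun i => ((x i * d (σ i) * x i : ℝ) : ℂ)) := by
    rw [permMatrix_conj_diagonal hσ, diagonal_mul_diagonal, diagonal_mul_diagonal]
    simp
  rw [this, matFun_diagonal, retr, trace_diagonal]
  simp

lemma exists_retr_matFun_conj_sqrtPerm {m : ℕ} (x d : Fin 2 → ℝ) (y e : ℝ) :
    ∃ z w : ℝ, z + w = (x 0 ^ 2 + x 1 ^ 2) * (d 0 + d 1) / 2 ∧
      z * w = x 0 ^ 2 * x 1 ^ 2 * (d 0 * d 1) ∧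
      ∀ h : ℝ → ℝ, retr (matFun h
        (diagonal (fun i => ((Fin.append x (fun _ : Fin m => y) i : ℝ) : ℂ)) *
          (sqrtPerm (Equiv.swap (Fin.castAdd m 0) (Fin.castAdd m 1)) *
            diagonal (fun i => ((Fin.append d (fun _ : Fin m => e) i : ℝ) : ℂ)) *
            (sqrtPerm (Equiv.swap (Fin.castAdd m 0) (Fin.castAdd m 1)))ᴴ) *
          diagonal (fun i => ((Fin.append x (fun _ : Fin m => y) i : ℝ) : ℂ)))) =
        h z + h w + m * h (y * e * y) := by
  have hσ : Equiv.swap (Fin.castAdd m (0 : Fin 2)) (Fin.castAdd m 1) *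
      Equiv.swap (Fin.castAdd m (0 : Fin 2)) (Fin.castAdd m 1) = 1 := Equiv.swap_mul_self _ _
  set X := Fin.append x (fun _ : Fin m => y) with hX
  set D := Fin.append d (fun _ : Fin m => e) with hD
  set σ := Equiv.swap (Fin.castAdd m (0 : Fin 2)) (Fin.castAdd m 1) with hσ_def
  have hM : (diagonal (fun i => (X i : ℂ)) * (sqrtPerm σ * diagonal (fun i => (D i : ℂ)) *
      (sqrtPerm σ)ᴴ) * diagonal (fun i => (X i : ℂ))).IsHermitian := by
    have hXh : (diagonal (fun i => (X i : ℂ)))ᴴ = diagonal (fun i => (X i : ℂ)) :=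
      isHermitian_diagonal_of_self_adjoint _ (by ext i; simp)
    nth_rewrite 2 [← hXh]
    exact isHermitian_mul_mul_conjTranspose _ (isHermitian_mul_mul_conjTranspose _
      (isHermitian_diagonal_of_self_adjoint _ (by ext i; simp)))
  obtain ⟨z, w, h1, h2, h3⟩ := exists_retr_matFun_block hM
    (N := !![(x 0 : ℂ) ^ 2 * (d 0 + d 1) / 2, Complex.I / 2 * (x 0 * x 1 * (d 0 - d 1));
      -(Complex.I / 2 * (x 0 * x 1 * (d 0 - d 1))), (x 1 : ℂ) ^ 2 * (d 0 + d 1) / 2])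
    (fun _ => y * e * y) (by
      have hσ0 : σ (Fin.castAdd m 0) = Fin.castAdd m 1 := Equiv.swap_apply_left _ _
      have hσ1 : σ (Fin.castAdd m 1) = Fin.castAdd m 0 := Equiv.swap_apply_right _ _
      have hne : ∀ (i : Fin 2) (j : Fin m), Fin.castAdd m i ≠ Fin.natAdd 2 j := fun i j => by
        simp [Fin.ext_iff]
        omega
      have hσr : ∀ i : Fin m, σ (Fin.natAdd 2 i) = Fin.natAdd 2 i := fun i =>
        Equiv.swap_apply_of_ne_of_ne (hne 0 i).symm (hne 1 i).symm
      rw [sqrtPerm_conj_diagonal hσ]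
      ext i j
      simp only [reindex_apply, submatrix_apply, Equiv.symm_symm, mul_diagonal, diagonal_mul,
        Matrix.add_apply, Matrix.sub_apply, Matrix.smul_apply, smul_eq_mul, Equiv.Perm.permMatrix,
        PEquiv.toMatrix_apply, Equiv.toPEquiv_apply, Option.mem_some_iff]
      rcases i with i | i <;> rcases j with j | j
      · fin_cases i <;> fin_cases j <;>
          simp [hσ0, hσ1, hX, hD] <;> ring
      · fin_cases i <;> simp [hσ0, hσ1, hne]
      · fin_cases j <;> simp [hσr, (hne _ _).symm]
      · by_cases hij : i = j <;> simp [hσr, hX, hD, hij]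
        ring_nf
        simp)
  refine ⟨z, w, ?_, ?_, fun h => ?_⟩
  · rw [trace_fin_two] at h1
    apply Complex.ofReal_injective
    push_cast
    rw [h1]
    simp
    ring
  · rw [det_fin_two] at h2
    apply Complex.ofReal_injective
    push_cast
    rw [h2]
    simp
    linear_combination (x 0 * x 1 * (d 0 - d 1) : ℂ) ^ 2 / 4 * Complex.I_sq
  · rw [h3]
    simp

/-- For `α ∈ (0,1) ∪ (1,∞)` the sandwiched Rényi quantity
`D'_α(A‖B) = tr((B^{(1−α)/(2α)} A B^{(1−α)/(2α)})^α)` is not a quantum `f`-divergence: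
no function `f` reproduces it through the spectral formula
`∑_{a∈σ(A)} ∑_{b∈σ(B)} b·f(a/b)·tr(P_a Q_b)` on positive definite density matrices. -/
theorem stmt4 (α : ℝ) (hα : α ∈ Set.Ioo (0:ℝ) 1 ∪ Set.Ioi (1:ℝ))
    (n : ℕ) (hn : 2 ≤ n) :
    ¬ ∃ f : ℝ → ℝ, ∀ A B : Matrix (Fin n) (Fin n) ℂ,
      A.PosDef → B.PosDef → A.trace = 1 → B.trace = 1 →
      (∑ a ∈ specSet A, ∑ b ∈ specSet B, b * f (a / b) * retr (eigProj A a * eigProj B b)) =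
        retr (rpowMat
          (rpowMat B ((1 - α) / (2 * α)) * A * rpowMat B ((1 - α) / (2 * α))) α) := by
  rintro ⟨f, hf⟩
  obtain ⟨m, rfl⟩ := Nat.exists_eq_add_of_le hn
  have hα0 : 0 < α := by
    rcases hα with h | h
    · exact h.1
    · exact zero_lt_one.trans h
  have hα1 : α ≠ 1 := by
    rcases hα with h | h
    · exact h.2.ne
    · exact (ne_of_gt h)
  set p := (1 - α) / (2 * α) with hp
  have hp0 : p ≠ 0 := div_ne_zero (sub_ne_zero.2 hα1.symm) (by positivity)
  obtain ⟨k, hk, hk1⟩ : ∃ k : ℝ, 0 < k ∧ (2 + m) * (2 * k) = 1 :=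
    ⟨1 / (2 * (2 + m)), by positivity, by field_simp⟩
  set d : Fin (2 + m) → ℝ := Fin.append ![3 * k, k] (fun _ => 2 * k) with hd
  have hdpos : ∀ i, 0 < d i := by
    refine Fin.addCases (fun i => ?_) (fun i => ?_)
    · fin_cases i <;> simp [hd, hk]
    · simp [hd, hk]
  have hdsum : ∑ i, (d i : ℂ) = 1 := by
    rw [← Complex.ofReal_sum, Fin.sum_univ_add]
    simp only [hd, Fin.append_left, Fin.append_right, Fin.sum_univ_two, Finset.sum_const,
      Finset.card_univ, Fintype.card_fin, nsmul_eq_mul, cons_val_zero, cons_val_one]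
    rw [show 3 * k + k + m * (2 * k) = 1 by linarith, Complex.ofReal_one]
  set σ := Equiv.swap (Fin.castAdd m (0 : Fin 2)) (Fin.castAdd m 1) with hσ_def
  have hσ : σ * σ = 1 := Equiv.swap_mul_self _ _
  have hDpd : (diagonal (fun i => (d i : ℂ))).PosDef :=
    posDef_diagonal_iff.2 fun i => by exact_mod_cast hdpos i
  set x : Fin (2 + m) → ℝ := Fin.append ![(3 * k) ^ p, k ^ p] (fun _ => (2 * k) ^ p) with hx
  have hdx : (fun i => ((d i ^ p : ℝ) : ℂ)) = fun i => (x i : ℂ) := by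
    funext i
    congr 1
    refine Fin.addCases (fun i => ?_) (fun i => ?_) i
    · fin_cases i <;> simp [hd, hx]
    · simp [hd, hx]
  have key : ∀ U : Matrix (Fin (2 + m)) (Fin (2 + m)) ℂ, Uᴴ * U = 1 →
      ∑ i, ∑ j, d j * f (d i / d j) * Complex.normSq (U j i) =
        retr (matFun (fun t => t ^ α) (diagonal (fun i => (x i : ℂ)) *
          (U * diagonal (fun i => (d i : ℂ)) * Uᴴ) * diagonal (fun i => (x i : ℂ)))) :=
    fun U hU => by
    have hA : (U * diagonal (fun i => (d i : ℂ)) * Uᴴ).PosDef :=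
      hDpd.mul_mul_conjTranspose_same
        (vecMul_injective_of_isUnit (IsUnit.of_mul_eq_one_right _ hU))
    have h := hf _ _ hA hDpd
      (by rw [trace_mul_comm, ← mul_assoc, hU, one_mul, trace_diagonal, hdsum])
      (by rw [trace_diagonal, hdsum])
    rw [spectral_sum_eq (fun a b => b * f (a / b)) hU] at h
    rw [h, rpowMat, rpowMat, matFun_diagonal, hdx]
  have hmid : 2 * retr (matFun (fun t => t ^ α) (diagonal (fun i => (x i : ℂ)) *
          (sqrtPerm σ * diagonal (fun i => (d i : ℂ)) * (sqrtPerm σ)ᴴ) *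
            diagonal (fun i => (x i : ℂ)))) =
      ∑ i, (x i * d i * x i) ^ α + ∑ i, (x i * d (σ i) * x i) ^ α := by
    have hS := key (σ.permMatrix ℂ) (by
      rw [permMatrix_conjTranspose_of_involution hσ, permMatrix_mul_self_of_involution hσ])
    have h1 := key ((1 : Equiv.Perm (Fin (2 + m))).permMatrix ℂ) (by simp)
    rw [retr_matFun_conj_perm_diagonal _ hσ] at hS
    rw [retr_matFun_conj_perm_diagonal _ (mul_one 1)] at h1
    simp only [Equiv.Perm.one_apply] at h1
    rw [← key _ (sqrtPerm_unitary hσ), ← hS, ← h1,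
      Finset.mul_sum, ← Finset.sum_add_distrib]
    refine Finset.sum_congr rfl fun i _ => ?_
    rw [Finset.mul_sum, ← Finset.sum_add_distrib]
    refine Finset.sum_congr rfl fun j _ => ?_
    rw [normSq_sqrtPerm, permMatrix_one]
    ring
  obtain ⟨z, w, hzw, hzw', hh⟩ := exists_retr_matFun_conj_sqrtPerm (m := m)
    ![(3 * k) ^ p, k ^ p] ![3 * k, k] ((2 * k) ^ p) (2 * k)
  have hσ0 : σ (Fin.castAdd m 0) = Fin.castAdd m 1 := Equiv.swap_apply_left _ _
  have hσ1 : σ (Fin.castAdd m 1) = Fin.castAdd m 0 := Equiv.swap_apply_right _ _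
  have hσr : ∀ i : Fin m, σ (Fin.natAdd 2 i) = Fin.natAdd 2 i := fun i =>
    Equiv.swap_apply_of_ne_of_ne (by simp [Fin.ext_iff]) (by simp [Fin.ext_iff]; omega)
  rw [hh, Fin.sum_univ_add, Fin.sum_univ_add, Fin.sum_univ_two, Fin.sum_univ_two, hσ0, hσ1] at hmid
  simp only [hσr, hd, hx, Fin.append_left, Fin.append_right, Finset.sum_const,
    Finset.card_univ, Fintype.card_fin, nsmul_eq_mul, cons_val_zero, cons_val_one] at hmid hzw hzw'
  have hs : 0 < (3 * k) ^ p := Real.rpow_pos_of_pos (by positivity) _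
  have ht : 0 < k ^ p := Real.rpow_pos_of_pos hk _
  set s := (3 * k) ^ p with hs_def
  set t := k ^ p with ht_def
  have hprod : 0 < z * w := by rw [hzw']; positivity
  have hsum : 0 < z + w := by rw [hzw]; positivity
  have hz : 0 < z := by
    by_contra! hz
    rcases mul_pos_iff.1 hprod with h | h <;> linarith [h.1, h.2]
  have hw : 0 < w := pos_of_mul_pos_right hprod hz.le
  rcases pair_eq_of_midpoint hα0 hα1 (x₁ := s * (3 * k) * s) (x₂ := t * k * t)
    (y₁ := s * k * s) (y₂ := t * (3 * k) * t) (by positivity) (by positivity) (by positivity)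
    (by positivity) hz hw (by ring) (by rw [hzw']; ring) (by rw [hzw]; ring)
    (by linarith) with h | h
  · have : 0 < s * k * s := by positivity
    linarith
  · have h2 : s ^ 2 = t ^ 2 := mul_left_cancel₀ (by positivity : 3 * k ≠ 0) (by linarith)
    have h3 : s = t := (pow_left_inj₀ hs.le ht.le two_ne_zero).1 h2
    have h4 := (Real.rpow_left_inj (by positivity) hk.le hp0).1 h3
    linarith
end

section
/- Let H be a finite-dimensional complex Hilbert space and let h:[0,∞)→[0,∞) be a strictly monotone increasing continuous function with h(0)=0. Then for all positive semidefinite operators B, C on H: B² ≤ C² in the Loewner order if and only if tr h(BAB) ≤ tr h(CAC) for every positive definite operator A on H. -/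
open Matrix
open scoped ComplexOrder

section Eigenvalues

variable {E : Type*} [NormedAddCommGroup E] [InnerProductSpace ℂ E] {n : ℕ}

theorem inner_eq_zero_of_mem_span (b : OrthonormalBasis (Fin n) ℂ E) {s : Finset (Fin n)} {v : E}
    (hv : v ∈ Submodule.span ℂ (b '' s)) {j : Fin n} (hj : j ∉ s) : inner ℂ (b j) v = 0 := by
  induction hv using Submodule.span_induction with
  | mem x hx =>
    obtain ⟨k, hk, rfl⟩ := hx
    exact b.orthonormal.inner_eq_zero (fun h => hj (h ▸ hk))
  | zero => simp
  | add x y _ _ hx hy => rw [inner_add_right, hx, hy, add_zero]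
  | smul a x _ hx => rw [inner_smul_right, hx, mul_zero]

theorem finrank_span_image (b : OrthonormalBasis (Fin n) ℂ E) (s : Finset (Fin n)) :
    Module.finrank ℂ (Submodule.span ℂ (b '' s)) = s.card := by
  classical
  rw [← Finset.coe_image, finrank_span_finset_eq_card,
    Finset.card_image_of_injective _ b.orthonormal.linearIndependent.injective]
  have := (b.orthonormal.linearIndependent.linearIndepOn (s := (s : Set (Fin n)))).id_image
  simpa using this

variable [FiniteDimensional ℂ E] {T S : E →ₗ[ℂ] E}

theorem re_inner_apply_self_eq_sum (hT : T.IsSymmetric) (hn : Module.finrank ℂ E = n) (v : E) :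
    RCLike.re (inner ℂ (T v) v) =
      ∑ j, hT.eigenvalues hn j * ‖inner ℂ (hT.eigenvectorBasis hn j) v‖ ^ 2 := by
  rw [← (hT.eigenvectorBasis hn).sum_inner_mul_inner (T v) v, map_sum]
  refine Finset.sum_congr rfl fun j _ => ?_
  rw [hT v, hT.apply_eigenvectorBasis, inner_smul_right, mul_assoc,
    ← inner_conj_symm v, RCLike.conj_mul]
  norm_cast

theorem eigenvalues_le_of_forall_mem (hT : T.IsSymmetric) (hn : Module.finrank ℂ E = n)
    (W : Submodule ℂ E) (i : Fin n) (hW : n ≤ Module.finrank ℂ W + i) (c : ℝ)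
    (hc : ∀ v ∈ W, RCLike.re (inner ℂ (T v) v) ≤ c * ‖v‖ ^ 2) : hT.eigenvalues hn i ≤ c := by
  set b := hT.eigenvectorBasis hn with hb
  set V := Submodule.span ℂ (b '' (Finset.Iic i)) with hV
  have hVd : Module.finrank ℂ V = i + 1 := by
    rw [hV, finrank_span_image, Fin.card_Iic]
  obtain ⟨v, hv, hv0⟩ : ∃ v ∈ V ⊓ W, v ≠ 0 := by
    apply Submodule.exists_mem_ne_zero_of_ne_bot
    intro h
    have h1 := Submodule.finrank_sup_add_finrank_inf_eq V W
    have h2 := Submodule.finrank_le (V ⊔ W)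
    rw [h, finrank_bot] at h1
    omega
  have h1 := hc v hv.2
  rw [re_inner_apply_self_eq_sum hT hn] at h1
  have h2 : hT.eigenvalues hn i * ‖v‖ ^ 2 ≤
      ∑ j, hT.eigenvalues hn j * ‖inner ℂ (b j) v‖ ^ 2 := by
    rw [← b.sum_sq_norm_inner_right v, Finset.mul_sum]
    refine Finset.sum_le_sum fun j _ => ?_
    by_cases hj : j ∈ Finset.Iic i
    · exact mul_le_mul_of_nonneg_right (hT.eigenvalues_antitone hn (Finset.mem_Iic.1 hj))
        (by positivity)
    · simp [inner_eq_zero_of_mem_span b hv.1 hj]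
  exact le_of_mul_le_mul_right (h2.trans h1) (by positivity)

theorem eigenvalues_le_eigenvalues (hT : T.IsSymmetric) (hS : S.IsSymmetric)
    (hn : Module.finrank ℂ E = n)
    (hTS : ∀ v, RCLike.re (inner ℂ (T v) v) ≤ RCLike.re (inner ℂ (S v) v)) (i : Fin n) :
    hT.eigenvalues hn i ≤ hS.eigenvalues hn i := by
  set b := hS.eigenvectorBasis hn with hb
  refine eigenvalues_le_of_forall_mem hT hn (Submodule.span ℂ (b '' (Finset.Ici i))) i ?_ _ ?_
  · rw [finrank_span_image, Fin.card_Ici]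
    omega
  · intro v hv
    refine (hTS v).trans ?_
    rw [re_inner_apply_self_eq_sum hS hn, ← b.sum_sq_norm_inner_right v, Finset.mul_sum]
    refine Finset.sum_le_sum fun j _ => ?_
    by_cases hj : j ∈ Finset.Ici i
    · exact mul_le_mul_of_nonneg_right (hS.eigenvalues_antitone hn (Finset.mem_Ici.1 hj))
        (by positivity)
    · rw [← hb, inner_eq_zero_of_mem_span b hv hj]
      simp

theorem exists_le_eigenvalues (hT : T.IsSymmetric) (hn : Module.finrank ℂ E = n) {c : ℝ} {v : E}
    (hv : v ≠ 0) (hc : c * ‖v‖ ^ 2 ≤ RCLike.re (inner ℂ (T v) v)) :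
    ∃ i, c ≤ hT.eigenvalues hn i := by
  by_contra! h
  rw [re_inner_apply_self_eq_sum hT hn, ← (hT.eigenvectorBasis hn).sum_sq_norm_inner_right v,
    Finset.mul_sum] at hc
  refine hc.not_gt (Finset.sum_lt_sum
    (fun j _ => mul_le_mul_of_nonneg_right (h j).le (by positivity)) ?_)
  by_contra! h0
  suffices h1 : ∀ j, inner ℂ (hT.eigenvectorBasis hn j) v = 0 by
    have h2 := (hT.eigenvectorBasis hn).sum_sq_norm_inner_right v
    simp only [h1, norm_zero, ne_eq, OfNat.ofNat_ne_zero, not_false_eq_true, zero_pow,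
      Finset.sum_const_zero] at h2
    exact hv (norm_eq_zero.1 (pow_eq_zero_iff two_ne_zero |>.1 h2.symm))
  intro j
  by_contra hj
  have := h0 j (Finset.mem_univ _)
  exact this.not_gt (mul_lt_mul_of_pos_right (h j) (by positivity))

end Eigenvalues

section TraceFunction

variable {n : ℕ} {X Y : Matrix (Fin n) (Fin n) ℂ}

theorem retr_matFun_eq_sum_roots (h : ℝ → ℝ) (hX : X.IsHermitian) :
    retr (matFun h X) = (X.charpoly.roots.map fun z => h z.re).sum := by
  rw [retr, matFun, dif_pos hX, hX.roots_charpoly_eq_eigenvalues, IsHermitian.cfc,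
    Unitary.conjStarAlgAut_apply, Matrix.trace_mul_cycle]
  simp [Matrix.trace_diagonal, List.sum_ofFn]

theorem retr_matFun_eq_sum_eigenvalues (h : ℝ → ℝ) (hX : X.IsHermitian) :
    retr (matFun h X) =
      ∑ i, h ((isSymmetric_toEuclideanLin_iff.mpr hX).eigenvalues finrank_euclideanSpace_fin i) := by
  have : (toEuclideanLin X).charpoly = X.charpoly := by
    rw [toEuclideanLin_eq_toLin_orthonormal, charpoly_toLin]
  rw [retr_matFun_eq_sum_roots h hX, ← this,
    (isSymmetric_toEuclideanLin_iff.mpr hX).roots_charpoly_eq_eigenvalues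
      finrank_euclideanSpace_fin]
  simp [List.sum_ofFn]

theorem retr_matFun_mono {h : ℝ → ℝ} (hh : MonotoneOn h (Set.Ici 0)) (hX : X.PosSemidef)
    (hY : Y.PosSemidef) (hXY : (Y - X).PosSemidef) :
    retr (matFun h X) ≤ retr (matFun h Y) := by
  rw [retr_matFun_eq_sum_eigenvalues h hX.1, retr_matFun_eq_sum_eigenvalues h hY.1]
  refine Finset.sum_le_sum fun i _ => hh ?_ ?_ ?_
  · exact (isPositive_toEuclideanLin_iff.2 hX).nonneg_eigenvalues _ i
  · exact (isPositive_toEuclideanLin_iff.2 hY).nonneg_eigenvalues _ i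
  · refine eigenvalues_le_eigenvalues _ _ _ (fun v => ?_) i
    have := (isPositive_toEuclideanLin_iff.2 hXY).2 v
    rw [map_sub, LinearMap.sub_apply, inner_sub_left, map_sub] at this
    linarith

theorem retr_matFun_conj_eq (h : ℝ → ℝ) (hX : X.IsHermitian) (D : Matrix (Fin n) (Fin n) ℂ) :
    retr (matFun h (X * (Dᴴ * D) * X)) = retr (matFun h (D * X ^ 2 * Dᴴ)) := by
  have h1 : (X * (Dᴴ * D) * X).IsHermitian := by
    simp [IsHermitian, conjTranspose_mul, hX.eq, mul_assoc]
  have h2 : (D * X ^ 2 * Dᴴ).IsHermitian := by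
    simp [IsHermitian, conjTranspose_mul, hX.eq, mul_assoc]
  rw [retr_matFun_eq_sum_roots h h1, retr_matFun_eq_sum_roots h h2,
    show X * (Dᴴ * D) * X = (X * Dᴴ) * (D * X) by noncomm_ring, charpoly_mul_comm,
    show D * X * (X * Dᴴ) = D * X ^ 2 * Dᴴ by noncomm_ring]

theorem inner_sandwich (hX : X.IsHermitian) (ε : ℝ) (x v : EuclideanSpace ℂ (Fin n)) :
    RCLike.re (inner ℂ (toEuclideanLin
      (X * (vecMulVec x (star (x : Fin n → ℂ)) + (ε : ℂ) • 1) * X) v) v) =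
      ‖inner ℂ (toEuclideanLin X x) v‖ ^ 2 + ε * ‖toEuclideanLin X v‖ ^ 2 := by
  have hs := isSymmetric_toEuclideanLin_iff.mpr hX
  have hA : ∀ w : EuclideanSpace ℂ (Fin n),
      toEuclideanLin (vecMulVec x (star (x : Fin n → ℂ)) + (ε : ℂ) • 1) w
        = inner ℂ x w • x + (ε : ℂ) • w := by
    intro w
    ext i
    simp [toLpLin_apply, vecMulVec_mulVec, smul_mulVec,
      EuclideanSpace.inner_eq_star_dotProduct, dotProduct_comm, mul_comm]
  have hm : ∀ (P Q : Matrix (Fin n) (Fin n) ℂ) (w : EuclideanSpace ℂ (Fin n)),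
      toEuclideanLin (P * Q) w = toEuclideanLin P (toEuclideanLin Q w) := by
    intro P Q w
    simp [toLpLin_apply, mulVec_mulVec]
  rw [hm, hm, hs, hA, inner_add_left, inner_smul_left, inner_smul_left, hs x v,
    RCLike.conj_mul, inner_self_eq_norm_sq_to_K, Complex.conj_ofReal]
  norm_cast
  rw [map_add]
  simp only [RCLike.re_eq_complex_re, Complex.re_ofReal_mul]
  rfl

theorem posDef_vecMulVec_add_smul_one (x : Fin n → ℂ) {ε : ℝ} (hε : 0 < ε) :
    (vecMulVec x (star x) + (ε : ℂ) • 1).PosDef :=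
  (PosDef.one.smul (by exact_mod_cast hε)).posSemidef_add (posSemidef_vecMulVec_self_star x)

open scoped MatrixOrder in
theorem exists_eq_conjTranspose_mul_self (hX : X.PosSemidef) :
    ∃ D : Matrix (Fin n) (Fin n) ℂ, X = Dᴴ * D :=
  CStarAlgebra.nonneg_iff_eq_star_mul_self.1 hX.nonneg

theorem posSemidef_sandwich {A : Matrix (Fin n) (Fin n) ℂ} (hX : X.IsHermitian)
    (hA : A.PosSemidef) : (X * A * X).PosSemidef := by
  simpa [hX.eq] using hA.conjTranspose_mul_mul_same X

theorem le_retr_matFun_sandwich {h : ℝ → ℝ} (hh_nonneg : ∀ x ∈ Set.Ici (0:ℝ), 0 ≤ h x)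
    (hh : MonotoneOn h (Set.Ici 0)) (hh0 : h 0 = 0) (hX : X.IsHermitian) {ε : ℝ} (hε : 0 < ε)
    (x : EuclideanSpace ℂ (Fin n)) :
    h (‖toEuclideanLin X x‖ ^ 2) ≤
      retr (matFun h (X * (vecMulVec x (star (x : Fin n → ℂ)) + (ε : ℂ) • 1) * X)) := by
  have hp := posSemidef_sandwich hX (posDef_vecMulVec_add_smul_one x hε).posSemidef
  have hnn := (isPositive_toEuclideanLin_iff.2 hp).nonneg_eigenvalues
    (finrank_euclideanSpace_fin (𝕜 := ℂ))
  rw [retr_matFun_eq_sum_eigenvalues h hp.1]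
  by_cases h0 : toEuclideanLin X x = 0
  · simpa [h0, hh0] using Finset.sum_nonneg fun i _ => hh_nonneg _ (hnn i)
  obtain ⟨i, hi⟩ := exists_le_eigenvalues (isSymmetric_toEuclideanLin_iff.mpr hp.1)
    finrank_euclideanSpace_fin (c := ‖toEuclideanLin X x‖ ^ 2) h0 (by
      rw [inner_sandwich hX, inner_self_eq_norm_sq_to_K, norm_pow, RCLike.norm_ofReal, abs_norm]
      nlinarith [mul_nonneg hε.le (sq_nonneg ‖toEuclideanLin X (toEuclideanLin X x)‖)])
  exact (hh (Set.mem_Ici.2 (by positivity)) (hnn i) hi).trans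
    (Finset.single_le_sum (f := fun i => h (LinearMap.IsSymmetric.eigenvalues _ _ i))
      (fun i _ => hh_nonneg _ (hnn i)) (Finset.mem_univ i))

theorem retr_matFun_sandwich_le {h : ℝ → ℝ} (hh_nonneg : ∀ x ∈ Set.Ici (0:ℝ), 0 ≤ h x)
    (hh : MonotoneOn h (Set.Ici 0)) (hX : X.IsHermitian) {c : ℝ} (hc0 : 0 ≤ c)
    (hc : ∀ v, ‖toEuclideanLin X v‖ ^ 2 ≤ c * ‖v‖ ^ 2) {ε : ℝ} (hε : 0 < ε)
    (x : EuclideanSpace ℂ (Fin n)) :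
    retr (matFun h (X * (vecMulVec x (star (x : Fin n → ℂ)) + (ε : ℂ) • 1) * X)) ≤
      h (‖toEuclideanLin X x‖ ^ 2 + ε * c) + n * h (ε * c) := by
  have hp := posSemidef_sandwich hX (posDef_vecMulVec_add_smul_one x hε).posSemidef
  have hnn := (isPositive_toEuclideanLin_iff.2 hp).nonneg_eigenvalues
    (finrank_euclideanSpace_fin (𝕜 := ℂ))
  have hεc : 0 ≤ ε * c := by positivity
  have hs : 0 ≤ ‖toEuclideanLin X x‖ ^ 2 + ε * c := by positivity
  rw [retr_matFun_eq_sum_eigenvalues h hp.1]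
  set T := isSymmetric_toEuclideanLin_iff.mpr hp.1
  have key : ∀ i, h (T.eigenvalues finrank_euclideanSpace_fin i) ≤
      (if i.val = 0 then h (‖toEuclideanLin X x‖ ^ 2 + ε * c) else 0) + h (ε * c) := by
    intro i
    split_ifs with hi
    · refine (hh (hnn i) hs ?_).trans (le_add_of_nonneg_right (hh_nonneg _ hεc))
      refine eigenvalues_le_of_forall_mem T _ ⊤ i (by simp) _ fun v _ => ?_
      rw [inner_sandwich hX]
      have h1 := norm_inner_le_norm (𝕜 := ℂ) (toEuclideanLin X x) v
      have h2 := pow_le_pow_left₀ (norm_nonneg _) h1 2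
      nlinarith [mul_le_mul_of_nonneg_left (hc v) hε.le]
    · rw [zero_add]
      refine hh (hnn i) hεc ?_
      refine eigenvalues_le_of_forall_mem T _ (ℂ ∙ toEuclideanLin X x)ᗮ i ?_ _ fun v hv => ?_
      · have h1 := Submodule.finrank_add_finrank_orthogonal (ℂ ∙ toEuclideanLin X x)
        have h2 := finrank_span_le_card (R := ℂ) {toEuclideanLin X x}
        rw [finrank_euclideanSpace_fin] at h1
        rw [Set.toFinset_singleton, Finset.card_singleton] at h2
        omega
      · rw [inner_sandwich hX, Submodule.mem_orthogonal_singleton_iff_inner_right.1 hv]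
        have := mul_le_mul_of_nonneg_left (hc v) hε.le
        simpa [mul_assoc] using this
  refine (Finset.sum_le_sum fun i _ => key i).trans ?_
  rw [Finset.sum_add_distrib]
  simp only [Finset.sum_const, Finset.card_univ, Fintype.card_fin, nsmul_eq_mul]
  gcongr
  cases n with
  | zero => simpa using hh_nonneg _ hs
  | succ k => simp

theorem norm_toEuclideanLin_le_of_forall_posDef {h : ℝ → ℝ}
    (hh_nonneg : ∀ x ∈ Set.Ici (0:ℝ), 0 ≤ h x)
    (hh_mono : StrictMonoOn h (Set.Ici 0))
    (hh_cont : ContinuousOn h (Set.Ici 0)) (hh0 : h 0 = 0)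
    (hX : X.IsHermitian) (hY : Y.IsHermitian)
    (H : ∀ A : Matrix (Fin n) (Fin n) ℂ, A.PosDef →
      retr (matFun h (X * A * X)) ≤ retr (matFun h (Y * A * Y)))
    (x : EuclideanSpace ℂ (Fin n)) :
    ‖toEuclideanLin X x‖ ^ 2 ≤ ‖toEuclideanLin Y x‖ ^ 2 := by
  set c := ‖(toEuclideanLin Y).toContinuousLinearMap‖ ^ 2 with hc_def
  have hc0 : 0 ≤ c := by positivity
  have hc : ∀ v, ‖toEuclideanLin Y v‖ ^ 2 ≤ c * ‖v‖ ^ 2 := by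
    intro v
    rw [hc_def, ← mul_pow]
    exact pow_le_pow_left₀ (norm_nonneg _)
      ((toEuclideanLin Y).toContinuousLinearMap.le_opNorm v) 2
  set s := ‖toEuclideanLin Y x‖ ^ 2 with hs_def
  have hs0 : 0 ≤ s := by positivity
  refine (hh_mono.le_iff_le (Set.mem_Ici.2 (by positivity)) (Set.mem_Ici.2 hs0)).1 ?_
  have hlim : ∀ a : ℝ, 0 ≤ a →
      Filter.Tendsto (fun ε : ℝ => h (a + ε * c)) (nhdsWithin 0 (Set.Ioi 0)) (nhds (h a)) := by
    intro a ha
    refine (hh_cont a ha).tendsto.comp (tendsto_nhdsWithin_iff.2 ⟨?_, ?_⟩)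
    · have : Continuous fun ε : ℝ => a + ε * c := by fun_prop
      simpa using (this.tendsto 0).mono_left nhdsWithin_le_nhds
    · filter_upwards [self_mem_nhdsWithin] with ε hε
      have : 0 < ε := hε
      exact Set.mem_Ici.2 (by positivity)
  have hl := (hlim s hs0).add ((hlim 0 le_rfl).const_mul (n : ℝ))
  simp only [hh0, mul_zero, add_zero, zero_add] at hl
  refine ge_of_tendsto hl ?_
  filter_upwards [self_mem_nhdsWithin] with ε hε
  exact (le_retr_matFun_sandwich hh_nonneg hh_mono.monotoneOn hh0 hX hε x).trans
    ((H _ (posDef_vecMulVec_add_smul_one x hε)).trans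
      (retr_matFun_sandwich_le hh_nonneg hh_mono.monotoneOn hY hc0 hc hε x))

end TraceFunction

/-- For strictly increasing continuous `h : [0,∞) → [0,∞)` with `h(0)=0`
and positive semidefinite `B, C`: `B² ≤ C²` in the Loewner order iff
`tr h(BAB) ≤ tr h(CAC)` for every positive definite `A`. -/
theorem stmt10 {n : ℕ} (h : ℝ → ℝ) (hh_nonneg : ∀ x ∈ Set.Ici (0:ℝ), 0 ≤ h x)
    (hh_mono : StrictMonoOn h (Set.Ici 0))
    (hh_cont : ContinuousOn h (Set.Ici 0)) (hh0 : h 0 = 0)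
    (B C : Matrix (Fin n) (Fin n) ℂ) (hB : B.PosSemidef) (hC : C.PosSemidef) :
    (C ^ 2 - B ^ 2).PosSemidef ↔
      ∀ A : Matrix (Fin n) (Fin n) ℂ, A.PosDef →
        retr (matFun h (B * A * B)) ≤ retr (matFun h (C * A * C)) := by
  constructor
  · intro hBC A hA
    obtain ⟨D, rfl⟩ := exists_eq_conjTranspose_mul_self hA.posSemidef
    rw [retr_matFun_conj_eq h hB.1, retr_matFun_conj_eq h hC.1]
    refine retr_matFun_mono hh_mono.monotoneOn ((hB.pow 2).mul_mul_conjTranspose_same D)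
      ((hC.pow 2).mul_mul_conjTranspose_same D) ?_
    rw [← sub_mul, ← mul_sub]
    exact hBC.mul_mul_conjTranspose_same D
  · intro H
    rw [← isPositive_toEuclideanLin_iff]
    refine ⟨isSymmetric_toEuclideanLin_iff.2 ((hC.pow 2).1.sub (hB.pow 2).1), fun x => ?_⟩
    have hsq : ∀ {X : Matrix (Fin n) (Fin n) ℂ}, X.IsHermitian →
        RCLike.re (inner ℂ (toEuclideanLin (X ^ 2) x) x) = ‖toEuclideanLin X x‖ ^ 2 := by
      intro X hX
      have : toEuclideanLin (X ^ 2) x = toEuclideanLin X (toEuclideanLin X x) := by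
        simp [toLpLin_apply, mulVec_mulVec, sq]
      rw [this, isSymmetric_toEuclideanLin_iff.mpr hX, inner_self_eq_norm_sq]
    have := norm_toEuclideanLin_le_of_forall_posDef hh_nonneg hh_mono hh_cont hh0 hB.1 hC.1 H x
    rw [map_sub, LinearMap.sub_apply, inner_sub_left, map_sub, hsq hC.1, hsq hB.1]
    linarith
end

section
/- For every α ∈ (0,1)∪(1,∞) and every finite-dimensional complex Hilbert space H with dim H ≥ 2, there exist positive definite density operators A, B on H such that tr(A^α B^{1−α}) ≠ tr((B^{(1−α)/(2α)} A B^{(1−α)/(2α)})^α). -/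
open Matrix
open scoped ComplexOrder

open scoped Matrix.Norms.L2Operator in
/-- A positive real power is continuous on Hermitian matrices. -/
theorem continuous_rpowMat {X : Type*} [TopologicalSpace X] {n : ℕ} {r : ℝ} (hr : 0 ≤ r)
    {M : X → Matrix (Fin n) (Fin n) ℂ} (hM : Continuous M) (hH : ∀ x, (M x).IsHermitian) :
    Continuous fun x => rpowMat (M x) r := by
  have h : Continuous fun x => cfc (fun t : ℝ => t ^ r) (M x) := by
    rw [← continuousOn_univ]
    refine ContinuousOn.cfc_of_mem_nhdsSet (s := Set.univ) (fun t : ℝ => t ^ r) Filter.univ_mem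
      hM.continuousOn (fun x _ => hH x) ?_
    exact (Real.continuous_rpow_const hr).continuousOn
  refine h.congr fun x => ?_
  rw [rpowMat, matFun, dif_pos (hH x), (hH x).cfc_eq]

/-- A function that agrees with an affine one at `a` and `b` acts affinely on Hermitian matrices
whose eigenvalues lie in `{a, b}`. -/
theorem matFun_eq_affine {n : ℕ} {K : Matrix (Fin n) (Fin n) ℂ} (hK : K.IsHermitian)
    {f : ℝ → ℝ} {a b p q : ℝ} (hsq : K * K = (a + b) • K - (a * b) • 1)
    (ha : f a = p * a + q) (hb : f b = p * b + q) :
    matFun f K = p • K + q • 1 := by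
  have hsa : IsSelfAdjoint K := hK
  have hspec : ∀ t ∈ spectrum ℝ K, t = a ∨ t = b := by
    intro t ht
    have h := spectrum.subset_polynomial_aeval K
      (Polynomial.X ^ 2 - Polynomial.C (a + b) * Polynomial.X + Polynomial.C (a * b))
      (Set.mem_image_of_mem _ ht)
    have h0 : Polynomial.aeval K
      (Polynomial.X ^ 2 - Polynomial.C (a + b) * Polynomial.X + Polynomial.C (a * b)) = 0 := by
      simp only [map_add, map_sub, map_mul, Polynomial.aeval_X, Polynomial.aeval_C,
        pow_two, hsq, Algebra.algebraMap_eq_smul_one, smul_mul_assoc, mul_smul_comm, one_mul,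
        add_mul, mul_one, smul_smul, add_smul]
      module
    rw [h0] at h
    rcases isEmpty_or_nonempty (Fin n) with he | he
    · exact absurd ht (by simp [spectrum.of_subsingleton])
    rw [spectrum.zero_eq] at h
    have h' : (t - a) * (t - b) = 0 := by
      have := Set.mem_singleton_iff.1 h
      simp at this
      linarith
    rcases mul_eq_zero.1 h' with h' | h'
    · exact Or.inl (by linarith)
    · exact Or.inr (by linarith)
  rw [matFun, dif_pos hK, ← hK.cfc_eq]
  have : cfc f K = cfc (fun t => p * t + q) K := by
    refine cfc_congr fun t ht => ?_
    rcases hspec t ht with rfl | rfl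
    · exact ha
    · exact hb
  rw [this, cfc_add_const q (fun t => p * t) K, cfc_const_mul_id p K,
    Algebra.algebraMap_eq_smul_one]

theorem rpowMat_vecMulVec {n : ℕ} (y : Fin n → ℂ) {c r : ℝ} (hc : 0 < c) (hr : r ≠ 0)
    (hy : star y ⬝ᵥ y = c) :
    rpowMat (vecMulVec y (star y)) r = (c ^ (r - 1)) • vecMulVec y (star y) := by
  have h := matFun_eq_affine (f := fun t => t ^ r) (a := 0) (b := c) (p := c ^ (r - 1)) (q := 0)
    (posSemidef_vecMulVec_self_star y).1 (by
      rw [vecMulVec_mul_vecMulVec, hy]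
      ext i j
      simp [vecMulVec_apply]
      ring) (by simp [Real.zero_rpow hr]) (by
      simp only [add_zero]
      rw [← Real.rpow_add_one hc.ne']
      simp)
  simpa [rpowMat] using h

theorem rpowMat_diagonal_ite {n : ℕ} (k : Fin n) {a b : ℝ} (hab : a ≠ b) (r : ℝ) :
    rpowMat (diagonal fun i => (((if i = k then a else b : ℝ)) : ℂ)) r =
      diagonal fun i => (((if i = k then a ^ r else b ^ r : ℝ)) : ℂ) := by
  have hab' : a - b ≠ 0 := sub_ne_zero.2 hab
  have h := matFun_eq_affine (f := fun t => t ^ r) (a := a) (b := b)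
    (p := (a ^ r - b ^ r) / (a - b)) (q := (a * b ^ r - b * a ^ r) / (a - b))
    (K := diagonal fun i => (((if i = k then a else b : ℝ)) : ℂ))
    (by
      rw [isHermitian_diagonal_iff]
      intro i
      exact Complex.conj_ofReal _)
    (by
      ext i j
      rcases eq_or_ne i j with rfl | hij
      · by_cases hi : i = k <;> simp [hi] <;> ring
      · simp [hij])
    (by field_simp; ring) (by field_simp; ring)
  rw [rpowMat, h]
  ext i j
  rcases eq_or_ne i j with rfl | hij
  · by_cases hi : i = k <;> simp only [Matrix.smul_apply, Matrix.add_apply, diagonal_apply_eq, one_apply_eq, hi,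
      if_true, if_false, Complex.real_smul, mul_one] <;> norm_cast <;> field_simp <;>
      ring
  · simp [hij]

/-- The power mean inequality is strict for two distinct positive numbers. -/
theorem half_add_rpow_ne {u v p : ℝ} (hu : 0 < u) (hv : 0 < v) (huv : u ≠ v) (hp : 0 < p)
    (hp1 : p ≠ 1) : ((u + v) / 2) ^ p ≠ (u ^ p + v ^ p) / 2 := by
  rcases lt_or_gt_of_ne hp1 with h | h
  · have := (Real.strictConcaveOn_rpow hp h).2 (Set.mem_Ici.2 hu.le) (Set.mem_Ici.2 hv.le) huv
      (one_half_pos (α := ℝ)) one_half_pos (by norm_num)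
    simp only [smul_eq_mul] at this
    rw [show (u + v) / 2 = 1 / 2 * u + 1 / 2 * v by ring]
    exact ne_of_gt (by linarith)
  · have := (strictConvexOn_rpow h).2 (Set.mem_Ici.2 hu.le) (Set.mem_Ici.2 hv.le) huv
      (one_half_pos (α := ℝ)) one_half_pos (by norm_num)
    simp only [smul_eq_mul] at this
    rw [show (u + v) / 2 = 1 / 2 * u + 1 / 2 * v by ring]
    exact ne_of_lt (by linarith)

/-- The unit vector `(e₀ + e₁) / √2`. -/
noncomputable def halfVec (m : ℕ) : Fin (m + 2) → ℂ :=
  fun i => if (i : ℕ) < 2 then (((√2)⁻¹ : ℝ) : ℂ) else 0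

theorem sum_halfVec (m : ℕ) (w : Fin (m + 2) → ℝ) :
    ∑ i, star (halfVec m i) * halfVec m i * (w i : ℂ) = (((w 0 + w 1) / 2 : ℝ) : ℂ) := by
  have h2 : ((√2)⁻¹ : ℝ) * (√2)⁻¹ = 1 / 2 := by
    rw [← mul_inv, Real.mul_self_sqrt (by norm_num)]; norm_num
  have h2' : (((√2)⁻¹ : ℝ) : ℂ) * (((√2)⁻¹ : ℝ) : ℂ) = 1 / 2 := by
    rw [← Complex.ofReal_mul, h2]; norm_num
  rw [Fin.sum_univ_succ, Fin.sum_univ_succ, Finset.sum_eq_zero]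
  · simp only [halfVec, Fin.val_zero, Fin.succ_zero_eq_one, Fin.val_one, Nat.one_lt_two, if_true,
      Nat.zero_lt_two, Complex.star_def, Complex.conj_ofReal, h2']
    push_cast
    ring
  · intro i _
    simp [halfVec]

theorem star_dotProduct_halfVec (m : ℕ) : star (halfVec m) ⬝ᵥ halfVec m = 1 := by
  have := sum_halfVec m fun _ => 1
  simpa [dotProduct] using this

/-- For every `α ∈ (0,1) ∪ (1,∞)` and every dimension `n ≥ 2` there are
positive definite density matrices `A, B` with
`tr(A^α B^{1−α}) ≠ tr((B^{(1−α)/(2α)} A B^{(1−α)/(2α)})^α)`. -/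
theorem stmt11 (α : ℝ) (hα : α ∈ Set.Ioo (0:ℝ) 1 ∪ Set.Ioi (1:ℝ))
    (n : ℕ) (hn : 2 ≤ n) :
    ∃ A B : Matrix (Fin n) (Fin n) ℂ, A.PosDef ∧ B.PosDef ∧ A.trace = 1 ∧ B.trace = 1 ∧
      (rpowMat A α * rpowMat B (1 - α)).trace ≠
        (rpowMat (rpowMat B ((1 - α) / (2 * α)) * A * rpowMat B ((1 - α) / (2 * α))) α).trace := by
  obtain ⟨m, rfl⟩ := Nat.exists_eq_add_of_le' hn
  have hα0 : 0 < α := by rcases hα with h | h; exacts [h.1, one_pos.trans h]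
  have hα1 : α ≠ 1 := by rcases hα with h | h; exacts [h.2.ne, ne_of_gt h]
  set a : ℝ := 2 / (m + 3) with ha
  set b : ℝ := 1 / (m + 3) with hb
  have ha0 : 0 < a := by positivity
  have hb0 : 0 < b := by positivity
  have hab : a ≠ b := (div_lt_div_of_pos_right one_lt_two (by positivity)).ne'
  set s : ℝ := (1 - α) / (2 * α) with hs
  set B : Matrix (Fin (m + 2)) (Fin (m + 2)) ℂ :=
    diagonal fun i => (((if i = 0 then a else b : ℝ)) : ℂ) with hB
  set P := vecMulVec (halfVec m) (star (halfVec m)) with hP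
  have hPpsd : P.PosSemidef := posSemidef_vecMulVec_self_star _
  have hPtr : P.trace = 1 := by
    rw [hP, trace_vecMulVec, dotProduct_comm, star_dotProduct_halfVec]
  set D : Matrix (Fin (m + 2)) (Fin (m + 2)) ℂ :=
    diagonal fun i => (((if i = 0 then a ^ s else b ^ s : ℝ)) : ℂ) with hD
  have hDH : D.IsHermitian := by
    rw [hD, isHermitian_diagonal_iff]
    intro i
    exact Complex.conj_ofReal _
  set A : ℝ → Matrix (Fin (m + 2)) (Fin (m + 2)) ℂ :=
    fun ε => (1 - ε) • P + (ε / (m + 2)) • 1 with hA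
  have hAH : ∀ ε, (A ε).IsHermitian := fun ε =>
    (IsSelfAdjoint.smul (.all _) hPpsd.1).add (IsSelfAdjoint.smul (.all _) isHermitian_one)
  have hAcont : Continuous A := by fun_prop
  have hBtr : B.trace = 1 := by
    rw [hB, trace_diagonal, Fin.sum_univ_succ]
    simp only [if_true, Fin.succ_ne_zero, if_false, Finset.sum_const, Finset.card_univ,
      Fintype.card_fin, nsmul_eq_mul]
    rw [ha, hb]
    have : (m : ℂ) + 3 ≠ 0 := by norm_cast
    push_cast
    field_simp
    ring
  have hBpd : B.PosDef := by
    rw [hB, posDef_diagonal_iff]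
    intro i
    split_ifs <;> exact_mod_cast ‹_›
  by_contra! hcon
  have heq : ∀ ε ∈ Set.Ioo (0 : ℝ) 1, (rpowMat (A ε) α * rpowMat B (1 - α)).trace =
      (rpowMat (D * A ε * D) α).trace := by
    intro ε hε
    have := hcon (A ε) B ?_ hBpd ?_ hBtr
    · rwa [hB, rpowMat_diagonal_ite 0 hab s] at this
    · refine PosDef.posSemidef_add (hPpsd.smul (sub_nonneg.2 hε.2.le)) ?_
      exact PosDef.one.smul (div_pos hε.1 (by positivity))
    · simp only [hA, trace_add, trace_smul, hPtr, trace_one, Fintype.card_fin, Complex.real_smul]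
      have : (m : ℂ) + 2 ≠ 0 := by norm_cast
      push_cast
      field_simp
      ring
  have hL : Continuous fun ε => (rpowMat (A ε) α * rpowMat B (1 - α)).trace :=
    ((continuous_rpowMat hα0.le hAcont hAH).matrix_mul continuous_const).matrix_trace
  have hR : Continuous fun ε => (rpowMat (D * A ε * D) α).trace := by
    refine (continuous_rpowMat hα0.le ?_ fun ε => ?_).matrix_trace
    · exact (continuous_const.matrix_mul hAcont).matrix_mul continuous_const
    · simpa [hDH.eq] using isHermitian_mul_mul_conjTranspose D (hAH ε)
  have h0 : (rpowMat (A 0) α * rpowMat B (1 - α)).trace = (rpowMat (D * A 0 * D) α).trace := by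
    refine tendsto_nhds_unique_of_eventuallyEq
      ((hL.tendsto 0).mono_left (nhdsWithin_le_nhds (s := Set.Ioi 0)))
      ((hR.tendsto 0).mono_left nhdsWithin_le_nhds) ?_
    filter_upwards [Ioo_mem_nhdsGT one_pos] with ε hε using heq ε hε
  have hA0 : A 0 = P := by simp [hA]
  set u : ℝ := a ^ (2 * s) with hu
  set v : ℝ := b ^ (2 * s) with hv
  have hu0 : 0 < u := by positivity
  have hv0 : 0 < v := by positivity
  have hs0 : 2 * s ≠ 0 := by
    rw [hs]
    have := sub_ne_zero.2 hα1.symm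
    positivity
  have huv : u ≠ v := fun h => hab ((Real.rpow_left_inj ha0.le hb0.le hs0).1 h)
  have hsα : 2 * s * α = 1 - α := by rw [hs]; field_simp
  have hLval : (rpowMat (A 0) α * rpowMat B (1 - α)).trace
      = (((u ^ α + v ^ α) / 2 : ℝ) : ℂ) := by
    rw [hA0, hP, rpowMat_vecMulVec _ one_pos hα0.ne' (by simpa using star_dotProduct_halfVec m),
      Real.one_rpow, one_smul, hB, rpowMat_diagonal_ite 0 hab, vecMulVec_mul, trace_vecMulVec,
      ← Real.rpow_mul ha0.le, ← Real.rpow_mul hb0.le, hsα]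
    have := sum_halfVec m fun i => if i = 0 then a ^ (1 - α) else b ^ (1 - α)
    simp only [if_true, one_ne_zero, if_false] at this
    rw [← this, dotProduct]
    refine Finset.sum_congr rfl fun i _ => ?_
    rw [vecMul_diagonal, Pi.star_apply]
    ring
  set y := D *ᵥ halfVec m with hy
  have hyy : star y ⬝ᵥ y = (((u + v) / 2 : ℝ) : ℂ) := by
    have := sum_halfVec m fun i => if i = 0 then u else v
    simp only [if_true, one_ne_zero, if_false] at this
    rw [← this, dotProduct]
    refine Finset.sum_congr rfl fun i _ => ?_
    have hw : (if i = 0 then u else v) =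
        (if i = 0 then a ^ s else b ^ s) * (if i = 0 then a ^ s else b ^ s) := by
      split_ifs
      · rw [hu, two_mul, Real.rpow_add ha0]
      · rw [hv, two_mul, Real.rpow_add hb0]
    rw [hw, hy, hD, Pi.star_apply, mulVec_diagonal, star_mul', Complex.star_def,
      Complex.conj_ofReal]
    push_cast
    ring
  have hRval : (rpowMat (D * A 0 * D) α).trace = ((((u + v) / 2) ^ α : ℝ) : ℂ) := by
    have hDP : D * A 0 * D = vecMulVec y (star y) := by
      rw [hA0, hP, mul_vecMulVec, vecMulVec_mul, hy, star_mulVec, hDH.eq]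
    have hc : 0 < (u + v) / 2 := by positivity
    rw [hDP, rpowMat_vecMulVec y hc hα0.ne' hyy, trace_smul, trace_vecMulVec, dotProduct_comm,
      hyy, Complex.real_smul, ← Complex.ofReal_mul, ← Real.rpow_add_one hc.ne', sub_add_cancel]
  rw [hLval, hRval] at h0
  exact half_add_rpow_ne hu0 hv0 huv hα0 hα1 (Complex.ofReal_injective h0).symm
end

section
/- Let H be a finite-dimensional complex Hilbert space. Let f:(0,∞)→(0,∞) be strictly monotone decreasing and strictly convex with lim_{ε→0⁺} f(ε)=+∞, and let g:[0,∞)→[0,∞) be strictly monotone increasing, continuous, with g(0)=0 and lim_{t→∞} g(t)=∞, and either strictly convex or strictly concave. Suppose φ: S(H) → S(H) satisfies D'_{f,g}(φ(A)‖φ(B)) = D'_{f,g}(A‖B) for all A, B ∈ S(H). Then tr(φ(P)φ(Q)) = tr(PQ) for all rank-one projections P, Q on H. -/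
open Matrix
open scoped ComplexOrder

lemma matFun_isHermitian {n : ℕ} (h : ℝ → ℝ) (A : Matrix (Fin n) (Fin n) ℂ) :
    (matFun h A).IsHermitian := by
  unfold matFun
  split_ifs with hA
  · rw [← hA.cfc_eq]
    exact cfc_predicate h A
  · exact isHermitian_zero

lemma matFun_mulVec_of_eigenvector {n : ℕ} (h : ℝ → ℝ) {A : Matrix (Fin n) (Fin n) ℂ}
    (hA : A.IsHermitian) {v : Fin n → ℂ} {μ : ℝ} (hv : A *ᵥ v = (μ : ℂ) • v) :
    matFun h A *ᵥ v = (h μ : ℂ) • v := by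
  let U : Matrix (Fin n) (Fin n) ℂ := (hA.eigenvectorUnitary).1
  have hUU : U * star U = 1 := Unitary.coe_mul_star_self _
  have hUU' : star U * U = 1 := Unitary.coe_star_mul_self _
  have hspec : A = U * diagonal (RCLike.ofReal ∘ hA.eigenvalues) * star U := by
    conv_lhs => rw [hA.spectral_theorem, Unitary.conjStarAlgAut_apply]
  have hfun : matFun h A = U * diagonal (RCLike.ofReal ∘ h ∘ hA.eigenvalues) * star U := by
    rw [matFun, dif_pos hA, IsHermitian.cfc, Unitary.conjStarAlgAut_apply]
  have key : diagonal (RCLike.ofReal ∘ hA.eigenvalues) *ᵥ (star U *ᵥ v)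
      = (μ : ℂ) • (star U *ᵥ v) := by
    rw [← mulVec_smul, ← hv]
    conv_rhs => rw [hspec]
    simp only [mulVec_mulVec, ← mul_assoc, hUU', one_mul]
  have key2 : diagonal (RCLike.ofReal ∘ h ∘ hA.eigenvalues) *ᵥ (star U *ᵥ v)
      = (h μ : ℂ) • (star U *ᵥ v) := by
    ext i
    have := congrFun key i
    simp only [mulVec_diagonal, Function.comp_apply, Pi.smul_apply, smul_eq_mul] at this ⊢
    rcases mul_eq_mul_right_iff.1 this with h1 | h1
    · have : hA.eigenvalues i = μ := Complex.ofReal_injective h1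
      rw [this]; rfl
    · rw [h1]; simp
  rw [hfun, ← mulVec_mulVec, ← mulVec_mulVec, key2, mulVec_smul, mulVec_mulVec, hUU, one_mulVec]

lemma matFun_vecMulVec {n : ℕ} {g : ℝ → ℝ} (hg0 : g 0 = 0) (v : Fin n → ℂ) {c : ℝ}
    (hc : star v ⬝ᵥ v = c) : retr (matFun g (vecMulVec v (star v))) = g c := by
  have hA : (vecMulVec v (star v)).IsHermitian := (posSemidef_vecMulVec_self_star v).1
  by_cases hc0 : c = 0
  · have : v = 0 := dotProduct_star_self_eq_zero.1 (by rw [hc, hc0]; simp)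
    have h2 : matFun g (vecMulVec v (star v)) = 0 := by
      apply ext_of_mulVec_single
      intro i
      rw [matFun_mulVec_of_eigenvector g hA (μ := 0) (by simp [this, -mulVec_single]), hg0,
        zero_mulVec, Complex.ofReal_zero, zero_smul]
    rw [h2, hc0, hg0]; simp [retr]
  · have hc' : (c : ℂ) ≠ 0 := by exact_mod_cast hc0
    have h2 : matFun g (vecMulVec v (star v)) = ((g c / c : ℝ) : ℂ) • vecMulVec v (star v) := by
      apply ext_of_mulVec_single
      intro i
      have hv : vecMulVec v (star v) *ᵥ v = (c : ℂ) • v := by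
        rw [vecMulVec_mulVec, hc]; ext j; simp [mul_comm]
      set e : Fin n → ℂ := Pi.single i 1
      have h0 : vecMulVec v (star v) *ᵥ (e - ((star v ⬝ᵥ e) / c) • v) = ((0 : ℝ) : ℂ) •
          (e - ((star v ⬝ᵥ e) / c) • v) := by
        rw [mulVec_sub, mulVec_smul, hv, vecMulVec_mulVec]
        ext j
        simp
        field_simp
        ring
      have h1 := matFun_mulVec_of_eigenvector g hA h0
      rw [hg0, mulVec_sub, mulVec_smul, matFun_mulVec_of_eigenvector g hA hv] at h1
      simp only [Complex.ofReal_zero, zero_smul, sub_eq_zero] at h1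
      rw [h1, smul_mulVec, vecMulVec_mulVec]
      ext j
      simp
      field_simp
    rw [h2, retr, trace_smul, trace_vecMulVec, dotProduct_comm, hc]
    simp
    field_simp

lemma suppLE_iff {n : ℕ} {A B : Matrix (Fin n) (Fin n) ℂ} (hA : A.IsHermitian)
    (hB : B.IsHermitian) : suppLE A B ↔ ∀ v, B *ᵥ v = 0 → A *ᵥ v = 0 := by
  constructor
  · intro h v hv
    apply dotProduct_star_self_eq_zero.1
    obtain ⟨w, hw⟩ := h ⟨A *ᵥ v, rfl⟩
    simp only [toLin'_apply] at hw
    rw [star_mulVec, hA.eq, ← dotProduct_mulVec, ← hw, dotProduct_mulVec, ← hB.eq, ← star_mulVec,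
      hv]
    simp
  · intro h
    have hs : ∀ {C : Matrix (Fin n) (Fin n) ℂ}, C.IsHermitian →
        (toEuclideanCLM (𝕜 := ℂ) C).IsSymmetric := fun hC =>
      isSymmetric_toEuclideanLin_iff.2 hC
    have hker : (toEuclideanCLM (𝕜 := ℂ) B).ker ≤ (toEuclideanCLM (𝕜 := ℂ) A).ker := by
      intro v hv
      have hv' : B *ᵥ v.ofLp = 0 := congrArg WithLp.ofLp hv
      exact congrArg (WithLp.toLp 2) (h _ hv')
    have hr := (ContinuousLinearMap.ker_le_ker_iff_range_le_range (hs hA) (hs hB)).1 hker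
    rintro _ ⟨w, rfl⟩
    obtain ⟨u, hu⟩ := hr ⟨WithLp.toLp 2 w, rfl⟩
    exact ⟨u.ofLp, congrArg WithLp.ofLp hu⟩

lemma star_smul_add_dotProduct {n : ℕ} (u₀ u₁ v₀ v₁ : Fin n → ℂ) (a b c d : ℂ) :
    star (a • u₀ + b • u₁) ⬝ᵥ (c • v₀ + d • v₁) =
      star a * c * (star u₀ ⬝ᵥ v₀) + star a * d * (star u₀ ⬝ᵥ v₁) +
      star b * c * (star u₁ ⬝ᵥ v₀) + star b * d * (star u₁ ⬝ᵥ v₁) := by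
  simp only [star_add, star_smul, add_dotProduct, dotProduct_add, smul_dotProduct, dotProduct_smul,
    smul_eq_mul]
  ring

lemma star_dotProduct_comm {n : ℕ} (u v : Fin n → ℂ) : star (star u ⬝ᵥ v) = star v ⬝ᵥ u := by
  exact (star_dotProduct v u).symm

/-- The (unnormalized) Bloch vector of a vector in `ℂ²`. -/
noncomputable def bloch (p : ℂ × ℂ) : Fin 3 → ℝ :=
  ![2 * (star p.1 * p.2).re, 2 * (star p.1 * p.2).im, Complex.normSq p.1 - Complex.normSq p.2]

/-- The squared norm of a vector in `ℂ²`. -/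
noncomputable def sqNorm (p : ℂ × ℂ) : ℝ := Complex.normSq p.1 + Complex.normSq p.2

lemma normSq_star_mul_add (p q : ℂ × ℂ) :
    Complex.normSq (star p.1 * q.1 + star p.2 * q.2) =
      (sqNorm p * sqNorm q + bloch p ⬝ᵥ bloch q) / 2 := by
  simp [bloch, sqNorm, Complex.normSq_apply, dotProduct, Fin.sum_univ_three]
  ring

lemma bloch_dotProduct_self (p : ℂ × ℂ) : bloch p ⬝ᵥ bloch p = sqNorm p ^ 2 := by
  simp [bloch, sqNorm, Complex.normSq_apply, dotProduct, Fin.sum_univ_three]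
  ring

lemma exists_bloch_eq {m : Fin 3 → ℝ} (hm : m ⬝ᵥ m = 1) : ∃ p, sqNorm p = 1 ∧ bloch p = m := by
  simp only [dotProduct, Fin.sum_univ_three] at hm
  by_cases h : m 2 = -1
  · refine ⟨(0, 1), by simp [sqNorm], ?_⟩
    rw [h] at hm
    have h0 : m 0 = 0 := by nlinarith [sq_nonneg (m 0), sq_nonneg (m 1)]
    have h1 : m 1 = 0 := by nlinarith [sq_nonneg (m 0), sq_nonneg (m 1)]
    ext i
    fin_cases i <;> simp [bloch, h0, h1, h]
  · have hpos : 0 < (1 + m 2) / 2 := by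
      have : -1 ≤ m 2 := by nlinarith [sq_nonneg (m 0), sq_nonneg (m 1)]
      have := lt_of_le_of_ne this (Ne.symm h)
      linarith
    set r := Real.sqrt ((1 + m 2) / 2) with hr
    have hr0 : 0 < r := Real.sqrt_pos.2 hpos
    have hr2 : r * r = (1 + m 2) / 2 := Real.mul_self_sqrt hpos.le
    have hβ : (m 0 / (2 * r)) * (m 0 / (2 * r)) + (m 1 / (2 * r)) * (m 1 / (2 * r))
        = (1 - m 2) / 2 := by
      have : (1 + m 2) ≠ 0 := by linarith
      have h4 : (2 * r) * (2 * r) = 2 * (1 + m 2) := by linarith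
      rw [div_mul_div_comm, div_mul_div_comm, h4, ← add_div]
      field_simp
      linarith
    refine ⟨((r : ℂ), (⟨m 0 / (2 * r), m 1 / (2 * r)⟩ : ℂ)), ?_, ?_⟩
    · simp only [sqNorm, Complex.normSq_apply, Complex.ofReal_re, Complex.ofReal_im]
      linarith
    · ext i
      fin_cases i
      · simp [bloch]; field_simp
      · simp [bloch]; field_simp
      · simp [bloch, Complex.normSq_apply]
        linarith

/-- A self-map of the Bloch sphere such that every affine function on the sphere is the pullback of
an affine function is orthogonal. -/
lemma bloch_dotProduct_eq_of_affine {ψ : ℂ × ℂ → ℂ × ℂ} (hψ : ∀ p, sqNorm p = 1 → sqNorm (ψ p) = 1)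
    (h : ∀ q, sqNorm q = 1 → ∃ (a : ℝ) (v : Fin 3 → ℝ), ∀ p, sqNorm p = 1 →
      bloch q ⬝ᵥ bloch p = a + v ⬝ᵥ bloch (ψ p))
    {p q : ℂ × ℂ} (hp : sqNorm p = 1) (hq : sqNorm q = 1) :
    bloch (ψ p) ⬝ᵥ bloch (ψ q) = bloch p ⬝ᵥ bloch q := by
  have hbasis : ∀ i : Fin 3, ∃ q, sqNorm q = 1 ∧ bloch q = Pi.single i 1 := fun i =>
    exists_bloch_eq (by simp)
  choose e he1 he using hbasis
  choose a v hav using fun i => h (e i) (he1 i)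
  let V : Matrix (Fin 3) (Fin 3) ℝ := of v
  have hV : ∀ p, sqNorm p = 1 → bloch p = a + V *ᵥ bloch (ψ p) := by
    intro p hp
    ext i
    have := hav i p hp
    rw [he, single_one_dotProduct] at this
    exact this
  have hneg : ∀ p, sqNorm p = 1 → ∃ p', sqNorm p' = 1 ∧ bloch p' = - bloch p := fun p hp =>
    exists_bloch_eq (by rw [neg_dotProduct_neg, bloch_dotProduct_self, hp]; norm_num)
  have hinv : ∀ i, ∃ c, V *ᵥ c = Pi.single i 1 := by
    intro i
    obtain ⟨p', hp', hb⟩ := hneg (e i) (he1 i)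
    refine ⟨(2⁻¹ : ℝ) • (bloch (ψ (e i)) - bloch (ψ p')), ?_⟩
    have h1 := hV _ (he1 i)
    have h2 := hV _ hp'
    rw [hb] at h2
    rw [mulVec_smul, mulVec_sub, ← he i]
    ext j
    have h1 := congrFun h1 j
    have h2 := congrFun h2 j
    simp only [Pi.add_apply, Pi.neg_apply, Pi.smul_apply, Pi.sub_apply, smul_eq_mul] at *
    linarith
  choose c hc using hinv
  let C : Matrix (Fin 3) (Fin 3) ℝ := (of c)ᵀ
  have hVC : V * C = 1 := by
    ext i j
    have := congrFun (hc j) i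
    simp only [mulVec, dotProduct] at this
    rw [mul_apply, one_apply]
    simpa [C, Pi.single_apply] using this
  have hCV : C * V = 1 := mul_eq_one_comm.1 hVC
  set t := - (C *ᵥ a) with ht
  have hC : ∀ p, sqNorm p = 1 → bloch (ψ p) = C *ᵥ bloch p + t := by
    intro p hp
    rw [hV p hp, mulVec_add, mulVec_mulVec, hCV, one_mulVec, ht]
    abel
  have hunit : ∀ m : Fin 3 → ℝ, m ⬝ᵥ m = 1 → (C *ᵥ m + t) ⬝ᵥ (C *ᵥ m + t) = 1 := by
    intro m hm
    obtain ⟨p, hp, rfl⟩ := exists_bloch_eq hm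
    rw [← hC p hp, bloch_dotProduct_self, hψ p hp]
    norm_num
  have horth : ∀ m : Fin 3 → ℝ, m ⬝ᵥ m = 1 → t ⬝ᵥ (C *ᵥ m) = 0 := by
    intro m hm
    have h1 := hunit m hm
    have h2 := hunit (-m) (by simpa using hm)
    simp only [mulVec_neg, add_dotProduct, dotProduct_add, neg_dotProduct, dotProduct_neg,
      dotProduct_comm (C *ᵥ m) t] at h1 h2
    linarith
  have ht0 : t = 0 := by
    have h0 : t ᵥ* C = 0 := by
      ext i
      have := horth (Pi.single i 1) (by simp)
      rw [dotProduct_mulVec, dotProduct_single_one] at this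
      exact this
    have : t ᵥ* (C * V) = 0 := by rw [← vecMul_vecMul, h0, zero_vecMul]
    rwa [hCV, vecMul_one] at this
  have hiso : ∀ m : Fin 3 → ℝ, (C *ᵥ m) ⬝ᵥ (C *ᵥ m) = m ⬝ᵥ m := by
    intro m
    by_cases hm : m = 0
    · simp [hm]
    · have hpos : 0 < m ⬝ᵥ m := by
        refine lt_of_le_of_ne ?_ (Ne.symm (mt dotProduct_self_eq_zero.1 hm))
        exact Finset.sum_nonneg fun i _ => mul_self_nonneg _
      set r := Real.sqrt (m ⬝ᵥ m) with hr
      have hr0 : 0 < r := Real.sqrt_pos.2 hpos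
      have hr2 : r * r = m ⬝ᵥ m := Real.mul_self_sqrt hpos.le
      have := hunit (r⁻¹ • m) (by
        rw [smul_dotProduct, dotProduct_smul, ← hr2, smul_eq_mul, smul_eq_mul]; field_simp)
      rw [ht0, add_zero, mulVec_smul, smul_dotProduct, dotProduct_smul, smul_eq_mul,
        smul_eq_mul] at this
      rw [← hr2]
      field_simp at this
      linarith
  rw [hC p hp, hC q hq, ht0, add_zero, add_zero]
  have h1 := hiso (bloch p + bloch q)
  simp only [mulVec_add, add_dotProduct, dotProduct_add, hiso] at h1
  rw [dotProduct_comm (C *ᵥ bloch q), dotProduct_comm (bloch q) (bloch p)] at h1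
  linarith

lemma Density.isHermitian {n : ℕ} (A : Density n) : A.1.IsHermitian := A.2.1.1

lemma Density.ne_zero {n : ℕ} (A : Density n) : A.1 ≠ 0 := fun h => by
  have := A.2.2
  rw [h, trace_zero] at this
  exact zero_ne_one this

/-- The kernel of a matrix. -/
noncomputable def mker {n : ℕ} (A : Matrix (Fin n) (Fin n) ℂ) : Submodule ℂ (Fin n → ℂ) :=
  LinearMap.ker A.mulVecLin

lemma mem_mker {n : ℕ} {A : Matrix (Fin n) (Fin n) ℂ} {v : Fin n → ℂ} :
    v ∈ mker A ↔ A *ᵥ v = 0 := Iff.rfl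

lemma suppLE_iff_mker_le {n : ℕ} (A B : Density n) : suppLE A.1 B.1 ↔ mker B.1 ≤ mker A.1 :=
  suppLE_iff A.isHermitian B.isHermitian

/-- The convex combination of two states with weights `s` and `1 - s`. -/
def Density.mix {n : ℕ} (A B : Density n) (s : ℝ) (h0 : 0 ≤ s) (h1 : s ≤ 1) : Density n :=
  ⟨(s : ℂ) • A.1 + ((1 - s : ℝ) : ℂ) • B.1,
    (A.2.1.smul (by exact_mod_cast h0)).add (B.2.1.smul (by exact_mod_cast sub_nonneg.2 h1)),
    by rw [trace_add, trace_smul, trace_smul, A.2.2, B.2.2]; simp⟩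

/-- The pure state given by a unit vector. -/
def Density.pure {n : ℕ} (x : Fin n → ℂ) (hx : star x ⬝ᵥ x = 1) : Density n :=
  ⟨vecMulVec x (star x), posSemidef_vecMulVec_self_star x,
    by rw [trace_vecMulVec, dotProduct_comm, hx]⟩

lemma mem_mker_pure {n : ℕ} {x : Fin n → ℂ} (hx : star x ⬝ᵥ x = 1) {v : Fin n → ℂ} :
    v ∈ mker (Density.pure x hx).1 ↔ star x ⬝ᵥ v = 0 := by
  have hx0 : x ≠ 0 := fun h => by simp [h] at hx
  rw [mem_mker, Density.pure, vecMulVec_mulVec]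
  simp [hx0]

lemma mker_mix {n : ℕ} (A B : Density n) {s : ℝ} (h0 : 0 < s) (h1 : s < 1) :
    mker (A.mix B s h0.le h1.le).1 = mker A.1 ⊓ mker B.1 := by
  ext v
  rw [Submodule.mem_inf, mem_mker, mem_mker, mem_mker, Density.mix]
  constructor
  · intro h
    have hA := A.2.1.dotProduct_mulVec_nonneg v
    have hB := B.2.1.dotProduct_mulVec_nonneg v
    have h2 : (s : ℂ) * (star v ⬝ᵥ (A.1 *ᵥ v)) + ((1 - s : ℝ) : ℂ) * (star v ⬝ᵥ (B.1 *ᵥ v)) = 0 := by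
      have := congrArg (star v ⬝ᵥ ·) h
      simpa only [add_mulVec, smul_mulVec, dotProduct_add, dotProduct_smul, smul_eq_mul,
        dotProduct_zero] using this
    have hs : (0 : ℂ) < s := by exact_mod_cast h0
    have hs' : (0 : ℂ) < ((1 - s : ℝ) : ℂ) := by exact_mod_cast sub_pos.2 h1
    have h3 := (add_eq_zero_iff_of_nonneg (mul_nonneg hs.le hA) (mul_nonneg hs'.le hB)).1 h2
    rw [← A.2.1.dotProduct_mulVec_zero_iff, ← B.2.1.dotProduct_mulVec_zero_iff]
    exact ⟨(mul_eq_zero.1 h3.1).resolve_left hs.ne', (mul_eq_zero.1 h3.2).resolve_left hs'.ne'⟩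
  · rintro ⟨hA, hB⟩
    rw [add_mulVec, smul_mulVec, smul_mulVec, hA, hB]
    simp

lemma exists_unit_smul {n : ℕ} {v : Fin n → ℂ} (hv : v ≠ 0) :
    ∃ c : ℂ, c ≠ 0 ∧ star (c • v) ⬝ᵥ (c • v) = 1 := by
  have h0 : 0 < star v ⬝ᵥ v := dotProduct_star_self_pos_iff.2 hv
  obtain ⟨r, hr⟩ : ∃ r : ℝ, star v ⬝ᵥ v = r := ⟨_, (Complex.eq_re_of_ofReal_le (r := 0) h0.le)⟩
  rw [hr] at h0
  have hr0 : 0 < r := by exact_mod_cast h0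
  have hs : Real.sqrt r * Real.sqrt r = r := Real.mul_self_sqrt hr0.le
  have hs0 : 0 < Real.sqrt r := Real.sqrt_pos.2 hr0
  refine ⟨((Real.sqrt r)⁻¹ : ℝ), by exact_mod_cast (inv_pos.2 hs0).ne', ?_⟩
  rw [star_smul, smul_dotProduct, dotProduct_smul, hr]
  simp only [smul_eq_mul, Complex.star_def, Complex.conj_ofReal]
  norm_cast
  nth_rewrite 3 [← hs]
  field_simp

lemma finrank_le_of_forall_dotProduct {n k : ℕ} {S T : Submodule ℂ (Fin n → ℂ)}
    (w : Fin k → Fin n → ℂ) (h : ∀ v ∈ S, (∀ i, star (w i) ⬝ᵥ v = 0) → v ∈ T) :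
    Module.finrank ℂ S ≤ Module.finrank ℂ T + k := by
  let L : S →ₗ[ℂ] (Fin k → ℂ) := (of fun i => star (w i)).mulVecLin ∘ₗ S.subtype
  have h1 := L.finrank_range_add_finrank_ker
  have h2 : Module.finrank ℂ (LinearMap.range L) ≤ k := by
    simpa using (LinearMap.range L).finrank_le
  have h3 : Module.finrank ℂ ((LinearMap.ker L).map S.subtype) ≤ Module.finrank ℂ T := by
    apply Submodule.finrank_mono
    rintro _ ⟨v, hv, rfl⟩
    exact h _ v.2 fun i => congrFun (LinearMap.mem_ker.1 hv) i
  rw [Submodule.finrank_map_subtype_eq] at h3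
  omega

/-- An order-reflecting map on supports does not decrease the dimension of the kernel. -/
lemma finrank_mker_le {n : ℕ} {φ : Density n → Density n}
    (hφ : ∀ A B : Density n, mker (φ B).1 ≤ mker (φ A).1 ↔ mker B.1 ≤ mker A.1) (A : Density n) :
    Module.finrank ℂ (mker A.1) ≤ Module.finrank ℂ (mker (φ A).1) := by
  induction hk : Module.finrank ℂ (mker A.1) generalizing A with
  | zero => exact Nat.zero_le _
  | succ k ih =>
    have hne : mker A.1 ≠ ⊥ := fun h => by rw [h, finrank_bot] at hk; omega
    obtain ⟨v, hvA, hv0⟩ := Submodule.exists_mem_ne_zero_of_ne_bot hne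
    obtain ⟨c, -, hc⟩ := exists_unit_smul hv0
    have hcA : c • v ∈ mker A.1 := Submodule.smul_mem _ _ hvA
    let A' := A.mix (Density.pure _ hc) (1 / 2) (by norm_num) (by norm_num)
    have hA' : mker A'.1 = mker A.1 ⊓ mker (Density.pure _ hc).1 :=
      mker_mix A _ (by norm_num) (by norm_num)
    have hlt : mker A'.1 < mker A.1 := by
      refine lt_of_le_of_ne (hA' ▸ inf_le_left) fun h => ?_
      rw [← h, hA'] at hcA
      have := (mem_mker_pure hc).1 hcA.2
      exact one_ne_zero (hc.symm.trans this)
    have hd : Module.finrank ℂ (mker A.1) ≤ Module.finrank ℂ (mker A'.1) + 1 := by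
      refine finrank_le_of_forall_dotProduct (fun _ : Fin 1 => c • v) fun u hu h => ?_
      rw [hA']
      exact ⟨hu, (mem_mker_pure hc).2 (h 0)⟩
    have hlt' := Submodule.finrank_lt_finrank_of_lt hlt
    have h1 := ih A' (by omega)
    have h2 : mker (φ A').1 < mker (φ A).1 :=
      lt_of_le_not_ge ((hφ A A').2 hlt.le) fun h => hlt.not_ge ((hφ A' A).1 h)
    have := Submodule.finrank_lt_finrank_of_lt h2
    omega

lemma exists_eq_vecMulVec {n : ℕ} (A : Density n) (h : n ≤ Module.finrank ℂ (mker A.1) + 1) :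
    ∃ x, star x ⬝ᵥ x = 1 ∧ A.1 = vecMulVec x (star x) := by
  obtain ⟨v, t, ht, hv0, hv⟩ := A.isHermitian.exists_eigenvector_of_ne_zero A.ne_zero
  obtain ⟨c, hc0, hc⟩ := exists_unit_smul hv0
  set x := c • v
  have hx0 : x ≠ 0 := smul_ne_zero hc0 hv0
  have hx : A.1 *ᵥ x = (t : ℂ) • x := by
    rw [mulVec_smul, hv, smul_comm]; rfl
  have hle : Submodule.span ℂ {x} ≤ LinearMap.range A.1.mulVecLin := by
    rw [Submodule.span_singleton_le_iff_mem]
    refine ⟨(t : ℂ)⁻¹ • x, ?_⟩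
    rw [mulVecLin_apply, mulVec_smul, hx, inv_smul_smul₀ (by exact_mod_cast ht)]
  have hspan : Submodule.span ℂ {x} = LinearMap.range A.1.mulVecLin := by
    apply Submodule.eq_of_le_of_finrank_le hle
    have := A.1.mulVecLin.finrank_range_add_finrank_ker
    rw [Module.finrank_fin_fun] at this
    rw [finrank_span_singleton hx0]
    unfold mker at h
    omega
  have hA : A.1 = (t : ℂ) • vecMulVec x (star x) := by
    apply ext_of_mulVec_single
    intro i
    set w : Fin n → ℂ := Pi.single i 1
    have hmem : A.1 *ᵥ w ∈ Submodule.span ℂ {x} := by rw [hspan]; exact ⟨w, rfl⟩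
    obtain ⟨d, hd⟩ := Submodule.mem_span_singleton.1 hmem
    have hd' : d = t * (star x ⬝ᵥ w) := by
      have h1 : star x ⬝ᵥ (A.1 *ᵥ w) = d := by rw [← hd, dotProduct_smul, hc, smul_eq_mul, mul_one]
      rw [← h1, dotProduct_mulVec, ← A.isHermitian.eq, ← star_mulVec, hx, star_smul,
        smul_dotProduct]
      simp
    rw [← hd, hd', smul_mulVec, vecMulVec_mulVec]
    ext j
    simp
    ring
  have htr := A.2.2
  rw [hA, trace_smul, trace_vecMulVec, dotProduct_comm, hc, smul_eq_mul, mul_one] at htr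
  exact ⟨x, hc, by rw [hA, htr, one_smul]⟩

/-- Two orthonormal vectors. -/
def IsOrthoPair {n : ℕ} (u₀ u₁ : Fin n → ℂ) : Prop :=
  star u₀ ⬝ᵥ u₀ = 1 ∧ star u₁ ⬝ᵥ u₁ = 1 ∧ star u₀ ⬝ᵥ u₁ = 0

/-- The linear combination of two vectors with the given coefficients. -/
def comb {n : ℕ} (u₀ u₁ : Fin n → ℂ) (p : ℂ × ℂ) : Fin n → ℂ := p.1 • u₀ + p.2 • u₁

lemma IsOrthoPair.star_comb_dotProduct {n : ℕ} {u₀ u₁ : Fin n → ℂ} (h : IsOrthoPair u₀ u₁)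
    (p q : ℂ × ℂ) : star (comb u₀ u₁ p) ⬝ᵥ comb u₀ u₁ q = star p.1 * q.1 + star p.2 * q.2 := by
  obtain ⟨h0, h1, h2⟩ := h
  have h3 : star u₁ ⬝ᵥ u₀ = 0 := by rw [← star_dotProduct_comm, h2, star_zero]
  rw [comb, comb, star_smul_add_dotProduct, h0, h1, h2, h3]
  ring

lemma IsOrthoPair.star_comb_dotProduct_self {n : ℕ} {u₀ u₁ : Fin n → ℂ} (h : IsOrthoPair u₀ u₁)
    (p : ℂ × ℂ) : star (comb u₀ u₁ p) ⬝ᵥ comb u₀ u₁ p = sqNorm p := by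
  rw [h.star_comb_dotProduct, sqNorm]
  simp [Complex.normSq_eq_conj_mul_self]

lemma IsOrthoPair.star_comb_dotProduct_self_eq_one {n : ℕ} {u₀ u₁ : Fin n → ℂ}
    (h : IsOrthoPair u₀ u₁) {p : ℂ × ℂ} (hp : sqNorm p = 1) :
    star (comb u₀ u₁ p) ⬝ᵥ comb u₀ u₁ p = 1 := by
  rw [h.star_comb_dotProduct_self, hp, Complex.ofReal_one]

lemma IsOrthoPair.trace_mul {n : ℕ} {u₀ u₁ : Fin n → ℂ} (h : IsOrthoPair u₀ u₁)
    {p q : ℂ × ℂ} (hp : sqNorm p = 1) (hq : sqNorm q = 1) :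
    (vecMulVec (comb u₀ u₁ p) (star (comb u₀ u₁ p)) *
      vecMulVec (comb u₀ u₁ q) (star (comb u₀ u₁ q))).trace =
      (((1 + bloch p ⬝ᵥ bloch q) / 2 : ℝ) : ℂ) := by
  have := normSq_star_mul_add q p
  rw [hp, hq, one_mul, dotProduct_comm] at this
  rw [← this, vecMulVec_mul_vecMulVec, vecMulVec_smul, trace_smul, trace_vecMulVec, smul_eq_mul,
    dotProduct_comm (comb u₀ u₁ p), ← star_dotProduct_comm, h.star_comb_dotProduct,
    Complex.star_def, Complex.normSq_eq_conj_mul_self]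

lemma exists_orthoPair_of_finrank_eq_two {n : ℕ} {S : Submodule ℂ (EuclideanSpace ℂ (Fin n))}
    (hS : Module.finrank ℂ S = 2) : ∃ u₀ u₁ : Fin n → ℂ, IsOrthoPair u₀ u₁ ∧
      ∀ x, WithLp.toLp 2 x ∈ S → ∃ p, x = comb u₀ u₁ p := by
  let b := (stdOrthonormalBasis ℂ S).reindex (finCongr hS)
  have hb : ∀ i j, star (b i).1.ofLp ⬝ᵥ (b j).1.ofLp = if i = j then 1 else 0 := by
    intro i j
    rw [← orthonormal_iff_ite.1 b.orthonormal i j, Submodule.coe_inner,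
      EuclideanSpace.inner_eq_star_dotProduct, dotProduct_comm]
  refine ⟨(b 0).1.ofLp, (b 1).1.ofLp, ⟨by simp [hb], by simp [hb], by simp [hb]⟩, fun x hx => ?_⟩
  have h := b.sum_repr ⟨_, hx⟩
  rw [Fin.sum_univ_two] at h
  exact ⟨(_, _), congrArg (fun y : S => y.1.ofLp) h.symm⟩

lemma exists_orthoPair_of_finrank_add_two {n : ℕ} {K : Submodule ℂ (Fin n → ℂ)}
    (hK : Module.finrank ℂ K + 2 = n) : ∃ u₀ u₁ : Fin n → ℂ, IsOrthoPair u₀ u₁ ∧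
      ∀ x, (∀ v ∈ K, star v ⬝ᵥ x = 0) → ∃ p, x = comb u₀ u₁ p := by
  let e := (WithLp.linearEquiv 2 ℂ (Fin n → ℂ)).symm
  let K' : Submodule ℂ (EuclideanSpace ℂ (Fin n)) := K.map e.toLinearMap
  have h1 : Module.finrank ℂ K' = Module.finrank ℂ K := e.finrank_map_eq K
  have h2 := K'.finrank_add_finrank_orthogonal
  rw [finrank_euclideanSpace_fin] at h2
  obtain ⟨u₀, u₁, hu, h⟩ := exists_orthoPair_of_finrank_eq_two (S := K'ᗮ) (by omega)
  refine ⟨u₀, u₁, hu, fun x hx => h x ?_⟩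
  rw [Submodule.mem_orthogonal]
  rintro _ ⟨v, hv, rfl⟩
  rw [EuclideanSpace.inner_eq_star_dotProduct, dotProduct_comm]
  exact hx v hv

lemma exists_re_star_comb_dotProduct_eq {n : ℕ} (a b : Fin n → ℂ) :
    ∃ (c : ℝ) (v : Fin 3 → ℝ), ∀ p, sqNorm p = 1 →
      (star (comb a b p) ⬝ᵥ comb a b p).re = c + v ⬝ᵥ bloch p := by
  refine ⟨((star a ⬝ᵥ a).re + (star b ⬝ᵥ b).re) / 2,
    ![(star a ⬝ᵥ b).re, - (star a ⬝ᵥ b).im, ((star a ⬝ᵥ a).re - (star b ⬝ᵥ b).re) / 2],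
    fun p hp => ?_⟩
  rw [comb, star_smul_add_dotProduct, ← star_dotProduct_comm a b]
  generalize star a ⬝ᵥ a = s
  generalize star b ⬝ᵥ b = t
  generalize star a ⬝ᵥ b = z
  rw [sqNorm] at hp
  simp [bloch, dotProduct, Fin.sum_univ_three, Complex.normSq_apply] at hp ⊢
  linear_combination ((s.re + t.re) / 2) * hp

lemma dfg_pure {n : ℕ} (f : ℝ → ℝ) {g : ℝ → ℝ} (hg0 : g 0 = 0) (x : Fin n → ℂ)
    (B : Matrix (Fin n) (Fin n) ℂ) :
    Dfg f g (vecMulVec x (star x)) B =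
      g (star (matFun (extZero f) B *ᵥ x) ⬝ᵥ (matFun (extZero f) B *ᵥ x)).re := by
  set y := matFun (extZero f) B *ᵥ x with hy
  have hyy : star y ⬝ᵥ y = ((star y ⬝ᵥ y).re : ℂ) :=
    Complex.eq_re_of_ofReal_le (r := 0) (by simp)
  rw [Dfg, mul_vecMulVec, vecMulVec_mul, ← matFun_vecMulVec hg0 y hyy]
  conv_rhs => rw [hy, star_mulVec, (matFun_isHermitian _ _).eq]

lemma IsOrthoPair.rotate {n : ℕ} {w₀ w₁ : Fin n → ℂ} (h : IsOrthoPair w₀ w₁) {q : ℂ × ℂ}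
    (hq : sqNorm q = 1) :
    IsOrthoPair (comb w₀ w₁ q) (comb w₀ w₁ (-star q.2, star q.1)) := by
  refine ⟨h.star_comb_dotProduct_self_eq_one hq, h.star_comb_dotProduct_self_eq_one ?_, ?_⟩
  · rw [← hq]
    simp [sqNorm, add_comm]
  · rw [h.star_comb_dotProduct]
    ring

lemma comb_eq_comb_rotate {n : ℕ} (w₀ w₁ : Fin n → ℂ) {q : ℂ × ℂ} (hq : sqNorm q = 1)
    (p : ℂ × ℂ) :
    comb w₀ w₁ p = comb (comb w₀ w₁ q) (comb w₀ w₁ (-star q.2, star q.1))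
      (star q.1 * p.1 + star q.2 * p.2, q.1 * p.2 - q.2 * p.1) := by
  have h : star q.1 * q.1 + star q.2 * q.2 = 1 := by
    have : ((sqNorm q : ℝ) : ℂ) = 1 := by rw [hq, Complex.ofReal_one]
    rw [← this, sqNorm]
    simp [Complex.normSq_eq_conj_mul_self]
  ext i
  simp only [comb, Pi.add_apply, Pi.smul_apply, smul_eq_mul]
  linear_combination (-(p.1 * w₀ i) - p.2 * w₁ i) * h

/-- The state with eigenvalues `1/3` and `2/3` on an orthonormal pair. -/
noncomputable def Density.ofPair {n : ℕ} {w₀ w₁ : Fin n → ℂ} (h : IsOrthoPair w₀ w₁) : Density n :=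
  (Density.pure w₀ h.1).mix (Density.pure w₁ h.2.1) (1 / 3) (by norm_num) (by norm_num)

lemma mem_mker_ofPair {n : ℕ} {w₀ w₁ : Fin n → ℂ} (h : IsOrthoPair w₀ w₁) {v : Fin n → ℂ} :
    v ∈ mker (Density.ofPair h).1 ↔ star w₀ ⬝ᵥ v = 0 ∧ star w₁ ⬝ᵥ v = 0 := by
  rw [Density.ofPair, mker_mix _ _ (by norm_num) (by norm_num), Submodule.mem_inf,
    mem_mker_pure, mem_mker_pure]

lemma star_matFun_ofPair {n : ℕ} {w₀ w₁ : Fin n → ℂ} (h : IsOrthoPair w₀ w₁) (k : ℝ → ℝ)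
    (p : ℂ × ℂ) :
    (star (matFun k (Density.ofPair h).1 *ᵥ comb w₀ w₁ p) ⬝ᵥ
      (matFun k (Density.ofPair h).1 *ᵥ comb w₀ w₁ p)).re =
      Complex.normSq p.1 * k (1 / 3) ^ 2 + Complex.normSq p.2 * k (2 / 3) ^ 2 := by
  have h10 : star w₁ ⬝ᵥ w₀ = 0 := by rw [← star_dotProduct_comm, h.2.2, star_zero]
  have h0 : (Density.ofPair h).1 *ᵥ w₀ = ((1 / 3 : ℝ) : ℂ) • w₀ := by
    simp only [Density.ofPair, Density.mix, Density.pure, add_mulVec, smul_mulVec,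
      vecMulVec_mulVec, h.1, h10]
    simp
  have h1 : (Density.ofPair h).1 *ᵥ w₁ = ((2 / 3 : ℝ) : ℂ) • w₁ := by
    simp only [Density.ofPair, Density.mix, Density.pure, add_mulVec, smul_mulVec,
      vecMulVec_mulVec, h.2.1, h.2.2]
    norm_num
  have hM : matFun k (Density.ofPair h).1 *ᵥ comb w₀ w₁ p =
      comb w₀ w₁ (k (1 / 3) * p.1, k (2 / 3) * p.2) := by
    rw [comb, mulVec_add, mulVec_smul, mulVec_smul,
      matFun_mulVec_of_eigenvector k (Density.isHermitian _) h0,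
      matFun_mulVec_of_eigenvector k (Density.isHermitian _) h1, comb, smul_smul, smul_smul,
      mul_comm p.1, mul_comm p.2]
  rw [hM, h.star_comb_dotProduct_self, sqNorm]
  simp only [Complex.normSq_mul, Complex.normSq_ofReal, Complex.ofReal_re]
  ring

section Preserver

variable {n : ℕ} {f g : ℝ → ℝ} {φ : Density n → Density n}

lemma mker_le_mker_iff (hφ : ∀ A B : Density n, DfgE f g (φ A).1 (φ B).1 = DfgE f g A.1 B.1)
    (A B : Density n) : mker (φ B).1 ≤ mker (φ A).1 ↔ mker B.1 ≤ mker A.1 := by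
  rw [← suppLE_iff_mker_le, ← suppLE_iff_mker_le]
  have h := hφ A B
  unfold DfgE at h
  split_ifs at h with h1 h2 h2
  · exact iff_of_true h1 h2
  · exact absurd h (EReal.coe_ne_top _)
  · exact absurd h.symm (EReal.coe_ne_top _)
  · exact iff_of_false h1 h2

lemma re_star_matFun_eq (hg_mono : StrictMonoOn g (Set.Ici 0)) (hg0 : g 0 = 0)
    (hφ : ∀ A B : Density n, DfgE f g (φ A).1 (φ B).1 = DfgE f g A.1 B.1)
    {A B : Density n} {x x' : Fin n → ℂ} (hA : A.1 = vecMulVec x (star x))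
    (hA' : (φ A).1 = vecMulVec x' (star x')) (hAB : mker B.1 ≤ mker A.1) :
    (star (matFun (extZero f) (φ B).1 *ᵥ x') ⬝ᵥ (matFun (extZero f) (φ B).1 *ᵥ x')).re =
      (star (matFun (extZero f) B.1 *ᵥ x) ⬝ᵥ (matFun (extZero f) B.1 *ᵥ x)).re := by
  have h := hφ A B
  rw [DfgE, if_pos ((suppLE_iff_mker_le _ _).2 ((mker_le_mker_iff hφ A B).2 hAB)), DfgE,
    if_pos ((suppLE_iff_mker_le _ _).2 hAB), hA, hA', dfg_pure f hg0, dfg_pure f hg0] at h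
  have hnn : ∀ y : Fin n → ℂ, (star y ⬝ᵥ y).re ∈ Set.Ici (0 : ℝ) := fun y =>
    (Complex.le_def.1 (dotProduct_star_self_nonneg y)).1
  exact hg_mono.injOn (hnn _) (hnn _) (EReal.coe_injective h)

lemma trace_map_mul_map (hf_pos : ∀ x ∈ Set.Ioi (0 : ℝ), 0 < f x)
    (hf_anti : StrictAntiOn f (Set.Ioi 0)) (hg_mono : StrictMonoOn g (Set.Ici 0)) (hg0 : g 0 = 0)
    (hφ : ∀ A B : Density n, DfgE f g (φ A).1 (φ B).1 = DfgE f g A.1 B.1)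
    {w₀ w₁ : Fin n → ℂ} (hw : IsOrthoPair w₀ w₁) {P Q : Density n} {p q : ℂ × ℂ}
    (hp : sqNorm p = 1) (hq : sqNorm q = 1)
    (hP : P.1 = vecMulVec (comb w₀ w₁ p) (star (comb w₀ w₁ p)))
    (hQ : Q.1 = vecMulVec (comb w₀ w₁ q) (star (comb w₀ w₁ q))) :
    ((φ P).1 * (φ Q).1).trace = (P.1 * Q.1).trace := by
  have hker := mker_le_mker_iff hφ
  let R : ∀ p, sqNorm p = 1 → Density n := fun p hp =>
    Density.pure (comb w₀ w₁ p) (hw.star_comb_dotProduct_self_eq_one hp)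
  have hrot := fun q (hq : sqNorm q = 1) => IsOrthoPair.rotate hw hq
  have hle : ∀ q hq p hp, mker (Density.ofPair (hrot q hq)).1 ≤ mker (R p hp).1 := by
    intro q hq p hp v hv
    obtain ⟨h0, h1⟩ := (mem_mker_ofPair _).1 hv
    rw [mem_mker_pure, comb_eq_comb_rotate w₀ w₁ hq p, comb, star_add, star_smul, star_smul,
      add_dotProduct, smul_dotProduct, smul_dotProduct, h0, h1]
    simp
  have he0 : sqNorm (1, 0) = 1 := by simp [sqNorm]
  have he1 : sqNorm (0, 1) = 1 := by simp [sqNorm]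
  set B₀ := Density.ofPair (hrot _ he0) with hB₀
  have hdim : Module.finrank ℂ (mker (φ B₀).1) + 2 = n := by
    have h1 : n ≤ Module.finrank ℂ (mker B₀.1) + 2 := by
      have := finrank_le_of_forall_dotProduct (S := ⊤) (T := mker B₀.1)
        ![comb w₀ w₁ (1, 0), comb w₀ w₁ (-star 0, star 1)]
        (fun v _ h => (mem_mker_ofPair _).2 ⟨h 0, h 1⟩)
      rwa [finrank_top, Module.finrank_fin_fun] at this
    have h2 := finrank_mker_le hker B₀
    have h3 : mker (φ B₀).1 < mker (φ (R _ he0)).1 := by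
      refine lt_of_le_not_ge ((hker _ _).2 (hle _ he0 _ he0)) fun h => ?_
      have h4 := ((hker _ _).1 h).trans (hle _ he0 _ he1)
      have h5 : comb w₀ w₁ (0, 1) ∈ mker (R _ he0).1 := by
        rw [mem_mker_pure, hw.star_comb_dotProduct]
        simp
      have h6 := (mem_mker_pure _).1 (h4 h5)
      rw [hw.star_comb_dotProduct] at h6
      simp at h6
    have h4 : mker (φ (R _ he0)).1 < ⊤ := by
      refine lt_top_iff_ne_top.2 fun h => (φ (R _ he0)).ne_zero ?_
      apply ext_of_mulVec_single
      intro i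
      have : Pi.single i 1 ∈ mker (φ (R _ he0)).1 := h ▸ Submodule.mem_top
      rw [mem_mker.1 this, zero_mulVec]
    have h5 := Submodule.finrank_lt_finrank_of_lt h3
    have h6 := Submodule.finrank_lt_finrank_of_lt h4
    rw [finrank_top, Module.finrank_fin_fun] at h6
    omega
  obtain ⟨u₀, u₁, hu, hspan⟩ := exists_orthoPair_of_finrank_add_two hdim
  have hψ : ∀ p, ∃ p', ∀ hp : sqNorm p = 1, sqNorm p' = 1 ∧
      (φ (R p hp)).1 = vecMulVec (comb u₀ u₁ p') (star (comb u₀ u₁ p')) := by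
    intro p
    by_cases hp : sqNorm p = 1
    · have h1 : n ≤ Module.finrank ℂ (mker (R p hp).1) + 1 := by
        have := finrank_le_of_forall_dotProduct (S := ⊤) (T := mker (R p hp).1)
          (fun _ : Fin 1 => comb w₀ w₁ p) (fun v _ h => (mem_mker_pure _).2 (h 0))
        rwa [finrank_top, Module.finrank_fin_fun] at this
      have h2 := finrank_mker_le hker (R p hp)
      obtain ⟨x, hx, hφx⟩ := exists_eq_vecMulVec (φ (R p hp)) (by omega)
      obtain ⟨p', rfl⟩ := hspan x fun v hv => by
        have h3 : v ∈ mker (Density.pure x hx).1 := by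
          have := (hker (R p hp) B₀).2 (hle _ he0 _ hp) hv
          rw [hφx] at this
          exact this
        rw [← star_dotProduct_comm, (mem_mker_pure hx).1 h3, star_zero]
      rw [hu.star_comb_dotProduct_self] at hx
      exact ⟨p', fun _ => ⟨Complex.ofReal_injective hx, hφx⟩⟩
    · exact ⟨p, fun h => absurd h hp⟩
  choose ψ hψ using hψ
  have haffine : ∀ q, sqNorm q = 1 → ∃ (a : ℝ) (v : Fin 3 → ℝ), ∀ p, sqNorm p = 1 →
      bloch q ⬝ᵥ bloch p = a + v ⬝ᵥ bloch (ψ p) := by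
    intro q hq
    set B := Density.ofPair (hrot q hq)
    set M := matFun (extZero f) (φ B).1
    obtain ⟨c, v, hcv⟩ := exists_re_star_comb_dotProduct_eq (M *ᵥ u₀) (M *ᵥ u₁)
    set s := f (1 / 3) ^ 2
    set t := f (2 / 3) ^ 2
    have hst : 0 < s - t := by
      have h1 : f (2 / 3) < f (1 / 3) :=
        hf_anti (by norm_num [Set.mem_Ioi]) (by norm_num [Set.mem_Ioi]) (by norm_num)
      have h2 : 0 < f (2 / 3) := hf_pos _ (by norm_num [Set.mem_Ioi])
      exact sub_pos.2 (pow_lt_pow_left₀ h1 h2.le two_ne_zero)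
    refine ⟨(2 * c - (s + t)) / (s - t), (2 / (s - t)) • v, fun p hp => ?_⟩
    have h1 := re_star_matFun_eq hg_mono hg0 hφ rfl (hψ p hp).2 (hle q hq p hp)
    have h2 : matFun (extZero f) (φ B).1 *ᵥ comb u₀ u₁ (ψ p) = comb (M *ᵥ u₀) (M *ᵥ u₁) (ψ p) := by
      rw [comb, comb, mulVec_add, mulVec_smul, mulVec_smul]
    rw [h2, hcv _ (hψ p hp).1, comb_eq_comb_rotate w₀ w₁ hq p, star_matFun_ofPair] at h1
    have h3 := normSq_star_mul_add q p
    have h4 : Complex.normSq (q.1 * p.2 - q.2 * p.1) = (1 - bloch q ⬝ᵥ bloch p) / 2 := by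
      have h5 : Complex.normSq (star q.1 * p.1 + star q.2 * p.2) +
          Complex.normSq (q.1 * p.2 - q.2 * p.1) = sqNorm q * sqNorm p := by
        simp [sqNorm, Complex.normSq_apply]
        ring
      rw [h3, hq, hp] at h5
      linarith
    rw [h3, h4, hq, hp] at h1
    simp only [extZero] at h1
    rw [if_pos (by norm_num), if_pos (by norm_num)] at h1
    change _ = _ * s + _ * t at h1
    rw [smul_dotProduct, smul_eq_mul]
    field_simp
    linarith
  have hfin := bloch_dotProduct_eq_of_affine (fun p hp => (hψ p hp).1) haffine hp hq
  have hPR : P = R p hp := Subtype.ext hP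
  have hQR : Q = R q hq := Subtype.ext hQ
  rw [hPR, hQR, (hψ p hp).2, (hψ q hq).2, hu.trace_mul (hψ p hp).1 (hψ q hq).1, hfin]
  exact (hw.trace_mul hp hq).symm

end Preserver

lemma eq_smul_or_exists_orthoPair {n : ℕ} {x y : Fin n → ℂ} (hx : star x ⬝ᵥ x = 1) :
    (∃ c : ℂ, y = c • x) ∨
      ∃ w₀ w₁ : Fin n → ℂ, IsOrthoPair w₀ w₁ ∧ ∃ p q, x = comb w₀ w₁ p ∧ y = comb w₀ w₁ q := by
  by_cases h : y - (star x ⬝ᵥ y) • x = 0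
  · exact Or.inl ⟨_, sub_eq_zero.1 h⟩
  · obtain ⟨c, hc0, hc⟩ := exists_unit_smul h
    refine Or.inr ⟨x, _, ⟨hx, hc, ?_⟩, (1, 0), (star x ⬝ᵥ y, c⁻¹), ?_, ?_⟩
    · rw [dotProduct_smul, dotProduct_sub, dotProduct_smul, hx]
      simp
    · simp [comb]
    · simp [comb, smul_smul, hc0]

/-- A map on densities preserving `D'_{f,g}`
(case `lim_{ε→0⁺} f(ε) = ∞`) preserves the transition probability between
rank-one projections. -/
theorem stmt18 {n : ℕ}
    (f : ℝ → ℝ) (hf_pos : ∀ x ∈ Set.Ioi (0:ℝ), 0 < f x)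
    (hf_anti : StrictAntiOn f (Set.Ioi 0))
    (hf_conv : StrictConvexOn ℝ (Set.Ioi 0) f)
    (hf_lim : Filter.Tendsto f (nhdsWithin 0 (Set.Ioi 0)) Filter.atTop)
    (g : ℝ → ℝ) (hg_nonneg : ∀ x ∈ Set.Ici (0:ℝ), 0 ≤ g x)
    (hg_mono : StrictMonoOn g (Set.Ici 0))
    (hg_cont : ContinuousOn g (Set.Ici 0)) (hg0 : g 0 = 0)
    (hg_top : Filter.Tendsto g Filter.atTop Filter.atTop)
    (hg_cc : StrictConvexOn ℝ (Set.Ici 0) g ∨ StrictConcaveOn ℝ (Set.Ici 0) g)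
    (φ : Density n → Density n)
    (hφ : ∀ A B : Density n, DfgE f g (φ A).1 (φ B).1 = DfgE f g A.1 B.1) :
    ∀ P Q : Density n, IsRankOneProj P.1 → IsRankOneProj Q.1 →
      ((φ P).1 * (φ Q).1).trace = (P.1 * Q.1).trace := by
  intro P Q ⟨x, hx, hP⟩ ⟨y, hy, hQ⟩
  have hker := mker_le_mker_iff hφ
  rcases eq_smul_or_exists_orthoPair (y := y) hx with ⟨c, rfl⟩ | ⟨w₀, w₁, hw, p, q, rfl, rfl⟩
  · have hc : star c * c = 1 := by
      rwa [star_smul, smul_dotProduct, dotProduct_smul, hx, smul_eq_mul, smul_eq_mul, mul_one]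
        at hy
    have hQP : Q = P := by
      apply Subtype.ext
      rw [hQ, hP, star_smul, smul_vecMulVec, vecMulVec_smul, smul_smul, mul_comm, hc, one_smul]
    have hone : ∀ {z : Fin n → ℂ}, star z ⬝ᵥ z = 1 →
        (vecMulVec z (star z) * vecMulVec z (star z)).trace = 1 := fun hz => by
      rw [vecMulVec_mul_vecMulVec, hz, one_smul, trace_vecMulVec, dotProduct_comm, hz]
    have h1 : n ≤ Module.finrank ℂ (mker P.1) + 1 := by
      have := finrank_le_of_forall_dotProduct (S := ⊤) (T := mker P.1) (fun _ : Fin 1 => x)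
        (fun v _ h => by rw [hP]; exact (mem_mker_pure hx).2 (h 0))
      rwa [finrank_top, Module.finrank_fin_fun] at this
    have h2 := finrank_mker_le hker P
    obtain ⟨z, hz, hφz⟩ := exists_eq_vecMulVec (φ P) (by omega)
    rw [hQP, hφz, hP, hone hz, hone hx]
  · rw [hw.star_comb_dotProduct_self] at hx hy
    exact trace_map_mul_map hf_pos hf_anti hg_mono hg0 hφ hw (Complex.ofReal_injective hx)
      (Complex.ofReal_injective hy) hP hQ
end

section
/- Let H be a finite-dimensional complex Hilbert space, α ∈ (0,1)∪(1,∞), and let φ: B(H)^{++} → B(H)^{++} be a bijective map satisfying D_α(φ(A)‖φ(B)) = D_α(A‖B) for all A, B ∈ B(H)^{++}. Then the map ψ: B(H)^{++} → B(H)^{++} defined by ψ(X) = ( φ( X^{α/(1−α)} ) )^{(1−α)/α} is a bijective order automorphism: for all X, Y ∈ B(H)^{++}, X ≤ Y in the Loewner order if and only if ψ(X) ≤ ψ(Y). -/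
open Matrix
open scoped ComplexOrder

section RealPowers

variable {n : ℕ} {A B : Matrix (Fin n) (Fin n) ℂ}

lemma matFun_eq_cfc (f : ℝ → ℝ) (A : Matrix (Fin n) (Fin n) ℂ) : matFun f A = cfc f A := by
  unfold matFun
  split_ifs with hA
  · exact (hA.cfc_eq f).symm
  · exact (cfc_apply_of_not_predicate A hA).symm

lemma Matrix.PosDef.rpowMat (hA : A.PosDef) (r : ℝ) : (rpowMat A r).PosDef := by
  rw [_root_.rpowMat, matFun, dif_pos hA.1, IsHermitian.cfc, Unitary.conjStarAlgAut_apply]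
  refine Matrix.PosDef.mul_mul_conjTranspose_same (posDef_diagonal_iff.mpr fun i => ?_) ?_
  · simpa using Real.rpow_pos_of_pos (hA.eigenvalues_pos i) r
  · rw [Matrix.vecMul_injective_iff_isUnit]
    exact Unitary.isUnit_coe

lemma Matrix.PosDef.pos_of_mem_spectrum (hA : A.PosDef) {t : ℝ} (ht : t ∈ spectrum ℝ A) :
    0 < t := by
  rw [hA.1.spectrum_real_eq_range_eigenvalues] at ht
  obtain ⟨i, rfl⟩ := ht
  exact hA.eigenvalues_pos i

lemma continuousOn_spectrum (f : ℝ → ℝ) (A : Matrix (Fin n) (Fin n) ℂ) :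
    ContinuousOn f (spectrum ℝ A) :=
  A.finite_real_spectrum.continuousOn f

lemma rpowMat_rpowMat (hA : A.PosDef) (p q : ℝ) :
    rpowMat (rpowMat A p) q = rpowMat A (p * q) := by
  simp only [rpowMat, matFun_eq_cfc]
  rw [← cfc_comp (fun t : ℝ => t ^ q) (fun t : ℝ => t ^ p) A hA.1.isSelfAdjoint
    ((A.finite_real_spectrum.image _).continuousOn _) (continuousOn_spectrum _ A)]
  exact cfc_congr fun t ht => (Real.rpow_mul (hA.pos_of_mem_spectrum ht).le p q).symm

lemma rpowMat_one (hA : A.PosDef) : rpowMat A 1 = A := by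
  simp only [rpowMat, matFun_eq_cfc, Real.rpow_one]
  exact cfc_id' ℝ A hA.1.isSelfAdjoint

lemma rpowMat_half_mul_self (hA : A.PosDef) : rpowMat A (1 / 2) * rpowMat A (1 / 2) = A := by
  conv_rhs => rw [← rpowMat_one hA]
  simp only [rpowMat, matFun_eq_cfc]
  rw [← cfc_mul _ _ A (continuousOn_spectrum _ A) (continuousOn_spectrum _ A)]
  refine cfc_congr fun t ht => ?_
  rw [← Real.rpow_add (hA.pos_of_mem_spectrum ht)]
  norm_num

lemma retr_matFun_s19 (hA : A.IsHermitian) (f : ℝ → ℝ) :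
    retr (matFun f A) = ∑ i, f (hA.eigenvalues i) := by
  rw [retr, matFun, dif_pos hA, IsHermitian.cfc, Unitary.conjStarAlgAut_apply, trace_mul_cycle]
  simp [trace_diagonal]

lemma retr_matFun_mul_comm (f : ℝ → ℝ) (h₁ : (A * B).IsHermitian) (h₂ : (B * A).IsHermitian) :
    retr (matFun f (A * B)) = retr (matFun f (B * A)) := by
  rw [retr_matFun_s19 h₁, retr_matFun_s19 h₂,
    (h₁.eigenvalues_eq_eigenvalues_iff h₂).mpr (charpoly_mul_comm A B)]

lemma sum_normSq_col_unitary (W : Matrix.unitaryGroup (Fin n) ℂ) (j : Fin n) :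
    ∑ i, Complex.normSq ((W : Matrix (Fin n) (Fin n) ℂ) i j) = 1 := by
  have h := congrFun (congrFun (Unitary.coe_star_mul_self W) j) j
  simp only [mul_apply, star_apply, one_apply_eq] at h
  have h' := congrArg Complex.re h
  simpa [Complex.normSq_apply, Complex.mul_re] using h'

lemma sum_normSq_row_unitary (W : Matrix.unitaryGroup (Fin n) ℂ) (i : Fin n) :
    ∑ j, Complex.normSq ((W : Matrix (Fin n) (Fin n) ℂ) i j) = 1 := by
  simpa using sum_normSq_col_unitary (star W) i

/-- The **Peierls inequality** for a convex function on `[0, ∞)`. -/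
lemma sum_diag_le_retr_matFun (hA : A.PosSemidef) (U : Matrix.unitaryGroup (Fin n) ℂ)
    {f : ℝ → ℝ} (hf : ConvexOn ℝ (Set.Ici 0) f) :
    ∑ j, f ((star (U : Matrix (Fin n) (Fin n) ℂ) * A * U) j j).re ≤ retr (matFun f A) := by
  set V := hA.1.eigenvectorUnitary with hV
  set W : Matrix.unitaryGroup (Fin n) ℂ := star V * U with hW
  have hdiag (j : Fin n) : ((star (U : Matrix (Fin n) (Fin n) ℂ) * A * U) j j).re =
      ∑ i, Complex.normSq ((W : Matrix (Fin n) (Fin n) ℂ) i j) • hA.1.eigenvalues i := by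
    have h : star (U : Matrix (Fin n) (Fin n) ℂ) * A * (U : Matrix (Fin n) (Fin n) ℂ) =
        star (W : Matrix (Fin n) (Fin n) ℂ) *
          diagonal (RCLike.ofReal ∘ hA.1.eigenvalues) * (W : Matrix (Fin n) (Fin n) ℂ) := by
      conv_lhs => rw [hA.1.spectral_theorem, Unitary.conjStarAlgAut_apply]
      simp [hW, hV, mul_assoc, star_mul]
    rw [h, mul_apply, Complex.re_sum]
    refine Finset.sum_congr rfl fun i _ => ?_
    rw [mul_diagonal, star_apply]
    simp [Complex.normSq_apply]
    ring
  rw [retr_matFun_s19 hA.1]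
  calc ∑ j, f ((star (U : Matrix (Fin n) (Fin n) ℂ) * A * U) j j).re
      ≤ ∑ j, ∑ i, Complex.normSq ((W : Matrix (Fin n) (Fin n) ℂ) i j) •
          f (hA.1.eigenvalues i) := by
        refine Finset.sum_le_sum fun j _ => ?_
        rw [hdiag]
        exact hf.map_sum_le (fun i _ => Complex.normSq_nonneg _) (sum_normSq_col_unitary W j)
          fun i _ => hA.eigenvalues_nonneg i
    _ = ∑ i, f (hA.1.eigenvalues i) := by
        rw [Finset.sum_comm]
        refine Finset.sum_congr rfl fun i _ => ?_
        rw [← Finset.sum_smul, sum_normSq_row_unitary, one_smul]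

lemma sum_diag_eigenvectorUnitary (hA : A.IsHermitian) (f : ℝ → ℝ) :
    ∑ j, f ((star (hA.eigenvectorUnitary : Matrix (Fin n) (Fin n) ℂ) * A *
      hA.eigenvectorUnitary) j j).re = retr (matFun f A) := by
  have h := hA.conjStarAlgAut_star_eigenvectorUnitary
  rw [Unitary.conjStarAlgAut_apply, Unitary.coe_star, star_star] at h
  rw [retr_matFun_s19 hA, h]
  simp

lemma re_diag_conj_le (hAB : (B - A).PosSemidef) (U : Matrix (Fin n) (Fin n) ℂ) (j : Fin n) :
    ((star U * A * U) j j).re ≤ ((star U * B * U) j j).re := by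
  have h := (hAB.conjTranspose_mul_mul_same U).diag_nonneg (i := j)
  rw [← star_eq_conjTranspose, mul_sub, sub_mul, Matrix.sub_apply] at h
  have := (Complex.le_def.mp h).1
  simp only [Complex.zero_re, Complex.sub_re] at this
  linarith

lemma re_diag_conj_nonneg (hA : A.PosSemidef) (U : Matrix (Fin n) (Fin n) ℂ) (j : Fin n) :
    0 ≤ ((star U * A * U) j j).re :=
  (Complex.le_def.mp (hA.conjTranspose_mul_mul_same U).diag_nonneg).1

/-- The trace of a positive real power is monotone in the Loewner order. -/
lemma retr_rpowMat_mono (hA : A.PosSemidef) (hB : B.PosSemidef) (hAB : (B - A).PosSemidef)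
    {α : ℝ} (hα : 0 < α) : retr (rpowMat A α) ≤ retr (rpowMat B α) := by
  have hmono {U : Matrix (Fin n) (Fin n) ℂ} (j : Fin n) :
      ((star U * A * U) j j).re ^ α ≤ ((star U * B * U) j j).re ^ α :=
    Real.rpow_le_rpow (re_diag_conj_nonneg hA U j) (re_diag_conj_le hAB U j) hα.le
  unfold rpowMat
  rcases le_total 1 α with h | h
  · rw [← sum_diag_eigenvectorUnitary hA.1]
    exact (Finset.sum_le_sum fun j _ => hmono j).trans
      (sum_diag_le_retr_matFun hB _ (convexOn_rpow h))
  · rw [← sum_diag_eigenvectorUnitary hB.1]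
    refine le_trans ?_ (Finset.sum_le_sum fun j _ => hmono j)
    have := sum_diag_le_retr_matFun hA hB.1.eigenvectorUnitary
      (Real.concaveOn_rpow hα.le h).neg
    rw [retr_matFun_s19 hA.1] at this ⊢
    simpa using this

lemma retr_rpowMat_pos [NeZero n] (hA : A.PosDef) (r : ℝ) : 0 < retr (rpowMat A r) := by
  rw [rpowMat, retr_matFun_s19 hA.1]
  exact Finset.sum_pos (fun i _ => Real.rpow_pos_of_pos (hA.eigenvalues_pos i) r)
    Finset.univ_nonempty

lemma Matrix.PosDef.mul_mul_same (hA : A.PosDef) (hB : B.PosDef) : (B * A * B).PosDef := by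
  have h := hA.mul_mul_conjTranspose_same (B := B)
    (Matrix.vecMul_injective_iff_isUnit.mpr hB.isUnit)
  rwa [hB.1.eq] at h

/-- The trace functional of a rank-one perturbation of a multiple of the identity. -/
lemma retr_matFun_vecMulVec_add (z : Fin n → ℂ) (δ : ℝ) (f : ℝ → ℝ) :
    retr (matFun f (vecMulVec z (star z) + (δ : ℂ) • 1)) =
      (n - 1) * f δ + f (δ + (star z ⬝ᵥ z).re) := by
  set c := (star z ⬝ᵥ z).re with hc
  have hcz : star z ⬝ᵥ z = (c : ℂ) := by
    have := Complex.le_def.mp (dotProduct_star_self_nonneg z)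
    exact Complex.ext (by simp [hc]) (by simpa using this.2.symm)
  set M := vecMulVec z (star z) + (δ : ℂ) • (1 : Matrix (Fin n) (Fin n) ℂ) with hM
  have hMh : M.IsHermitian := by
    refine (posSemidef_vecMulVec_self_star z).1.add ?_
    simp [IsHermitian, conjTranspose_smul]
  have hlam (i : Fin n) : hMh.eigenvalues i = δ ∨ hMh.eigenvalues i = δ + c := by
    set v : Fin n → ℂ := ⇑(hMh.eigenvectorBasis i) with hv
    have hv0 : v ≠ 0 := by
      intro h0
      refine hMh.eigenvectorBasis.orthonormal.ne_zero i ?_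
      ext j
      exact congrFun h0 j
    have he : (star z ⬝ᵥ v) • z = ((hMh.eigenvalues i - δ : ℝ) : ℂ) • v := by
      have := hMh.mulVec_eigenvectorBasis i
      have hMv : M *ᵥ v = (star z ⬝ᵥ v) • z + (δ : ℂ) • v := by
        rw [hM, add_mulVec, vecMulVec_mulVec, smul_mulVec, one_mulVec, op_smul_eq_smul]
      rw [← hv, hMv] at this
      ext j
      have := congrFun this j
      simp at this ⊢
      linear_combination this
    have he2 : (((hMh.eigenvalues i - δ : ℝ) : ℂ) * (hMh.eigenvalues i - δ - c : ℝ)) • v = 0 := by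
      have h2 := congrArg (star z ⬝ᵥ ·) he
      simp only [dotProduct_smul, hcz, smul_eq_mul] at h2
      ext j
      have h3 := congrFun he j
      simp only [Pi.smul_apply, smul_eq_mul, Pi.zero_apply] at h3 ⊢
      push_cast at h2 h3 ⊢
      linear_combination ((c : ℂ) - (hMh.eigenvalues i - δ)) * h3 - z j * h2
    have h3 := (smul_eq_zero.mp he2).resolve_right hv0
    rcases mul_eq_zero.mp h3 with h | h
    · left; exact sub_eq_zero.mp (by exact_mod_cast h)
    · right
      have : hMh.eigenvalues i - δ - c = 0 := by exact_mod_cast h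
      linarith
  have htr : ∑ i, hMh.eigenvalues i = c + n * δ := by
    have h := hMh.trace_eq_sum_eigenvalues
    have hMt : M.trace = c + δ * n := by
      rw [hM, trace_add, trace_vecMulVec, dotProduct_comm, hcz, trace_smul, trace_one]
      simp
    rw [hMt] at h
    have := congrArg Complex.re h
    simp at this
    linarith
  rw [retr_matFun_s19 hMh]
  rcases eq_or_ne c 0 with h0 | h0
  · have (i : Fin n) : f (hMh.eigenvalues i) = f δ := by
      rcases hlam i with h | h <;> simp [h, h0]
    simp [this, h0]
    ring
  · have (i : Fin n) : f (hMh.eigenvalues i) =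
        f δ + (f (δ + c) - f δ) / c * (hMh.eigenvalues i - δ) := by
      rcases hlam i with h | h <;> rw [h]
      · ring
      · field_simp
        ring
    rw [Finset.sum_congr rfl fun i _ => this i, Finset.sum_add_distrib, ← Finset.mul_sum,
      Finset.sum_sub_distrib, htr]
    simp
    field_simp
    ring

lemma conj_vecMulVec_star (hA : A.IsHermitian) (x : Fin n → ℂ) :
    A * vecMulVec x (star x) * A = vecMulVec (A *ᵥ x) (star (A *ᵥ x)) := by
  rw [mul_vecMulVec, vecMulVec_mul, star_mulVec, hA.eq]

lemma star_rpowMat_half_mulVec_dotProduct (hA : A.PosDef) (x : Fin n → ℂ) :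
    star (rpowMat A (1 / 2) *ᵥ x) ⬝ᵥ (rpowMat A (1 / 2) *ᵥ x) = star x ⬝ᵥ (A *ᵥ x) := by
  rw [star_mulVec, (hA.rpowMat _).1.eq, ← dotProduct_mulVec, mulVec_mulVec,
    rpowMat_half_mul_self hA]

lemma retr_rpowMat_half_conj_comm (hA : A.PosDef) (hB : B.PosDef) (α : ℝ) :
    retr (rpowMat (rpowMat A (1 / 2) * B * rpowMat A (1 / 2)) α) =
      retr (rpowMat (rpowMat B (1 / 2) * A * rpowMat B (1 / 2)) α) := by
  have h₁ : rpowMat A (1 / 2) * B * rpowMat A (1 / 2) =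
      (rpowMat A (1 / 2) * rpowMat B (1 / 2)) * (rpowMat B (1 / 2) * rpowMat A (1 / 2)) := by
    conv_lhs => rw [← rpowMat_half_mul_self hB]
    simp only [mul_assoc]
  have h₂ : rpowMat B (1 / 2) * A * rpowMat B (1 / 2) =
      (rpowMat B (1 / 2) * rpowMat A (1 / 2)) * (rpowMat A (1 / 2) * rpowMat B (1 / 2)) := by
    conv_lhs => rw [← rpowMat_half_mul_self hA]
    simp only [mul_assoc]
  have h₃ := (hB.mul_mul_same (hA.rpowMat (1 / 2))).1
  have h₄ := (hA.mul_mul_same (hB.rpowMat (1 / 2))).1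
  rw [h₁] at h₃ ⊢
  rw [h₂] at h₄ ⊢
  exact retr_matFun_mul_comm _ h₃ h₄

/-- The Loewner order is determined by the functionals `X ↦ tr (X^{1/2} A X^{1/2})^α`. -/
lemma posSemidef_sub_iff_forall_retr_le {X Y : Matrix (Fin n) (Fin n) ℂ} (hX : X.PosDef)
    (hY : Y.PosDef) {α : ℝ} (hα : 0 < α) :
    (Y - X).PosSemidef ↔ ∀ A : Matrix (Fin n) (Fin n) ℂ, A.PosDef →
      retr (rpowMat (rpowMat X (1 / 2) * A * rpowMat X (1 / 2)) α) ≤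
        retr (rpowMat (rpowMat Y (1 / 2) * A * rpowMat Y (1 / 2)) α) := by
  constructor
  · intro h A hA
    rw [retr_rpowMat_half_conj_comm hX hA, retr_rpowMat_half_conj_comm hY hA]
    have hC := hA.rpowMat (1 / 2)
    refine retr_rpowMat_mono (hX.mul_mul_same hC).posSemidef (hY.mul_mul_same hC).posSemidef ?_ hα
    have := h.mul_mul_conjTranspose_same (rpowMat A (1 / 2))
    rwa [hC.1.eq, mul_sub, sub_mul] at this
  · intro h
    refine .of_dotProduct_mulVec_nonneg (hY.1.sub hX.1) fun x => ?_
    set S := rpowMat X (1 / 2) with hS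
    set T := rpowMat Y (1 / 2) with hT
    have hSp : S.PosDef := hX.rpowMat _
    have hTp : T.PosDef := hY.rpowMat _
    have hTYT : T * Y⁻¹ * T = 1 := by
      rw [← rpowMat_half_mul_self hY, ← hT, Matrix.mul_inv_rev, ← mul_assoc,
        Matrix.mul_nonsing_inv _ ((Matrix.isUnit_iff_isUnit_det _).mp hTp.isUnit), one_mul,
        Matrix.nonsing_inv_mul _ ((Matrix.isUnit_iff_isUnit_det _).mp hTp.isUnit)]
    set a := (star x ⬝ᵥ (X *ᵥ x)).re with ha
    set b := (star x ⬝ᵥ (Y *ᵥ x)).re with hb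
    have key (ε : ℝ) (hε : 0 < ε) :
        (n - 1) * (0 : ℝ) ^ α + (0 + a) ^ α ≤ (n - 1) * ε ^ α + (ε + b) ^ α := by
      have hεY : ((ε : ℂ) • Y⁻¹).PosDef := hY.inv.smul (by exact_mod_cast hε)
      have hR := posSemidef_vecMulVec_self_star x
      have hA : (vecMulVec x (star x) + (ε : ℂ) • Y⁻¹).PosDef := Matrix.PosDef.posSemidef_add hR hεY
      have h₁ := h _ hA
      have h₂ : T * (vecMulVec x (star x) + (ε : ℂ) • Y⁻¹) * T =
          vecMulVec (T *ᵥ x) (star (T *ᵥ x)) + (ε : ℂ) • 1 := by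
        rw [mul_add, add_mul, conj_vecMulVec_star hTp.1, mul_smul_comm, smul_mul_assoc, hTYT]
      have h₃ : retr (rpowMat (vecMulVec (S *ᵥ x) (star (S *ᵥ x)) + ((0 : ℝ) : ℂ) • 1) α) ≤
          retr (rpowMat (S * (vecMulVec x (star x) + (ε : ℂ) • Y⁻¹) * S) α) := by
        rw [Complex.ofReal_zero, zero_smul, add_zero]
        refine retr_rpowMat_mono (posSemidef_vecMulVec_self_star _)
          (hA.mul_mul_same hSp).posSemidef ?_ hα
        rw [mul_add, add_mul, conj_vecMulVec_star hSp.1, add_sub_cancel_left]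
        exact (hεY.mul_mul_same hSp).posSemidef
      rw [h₂] at h₁
      have h₄ := h₃.trans h₁
      rw [rpowMat, rpowMat, retr_matFun_vecMulVec_add, retr_matFun_vecMulVec_add,
        star_rpowMat_half_mulVec_dotProduct hX, star_rpowMat_half_mulVec_dotProduct hY] at h₄
      exact h₄
    have ha0 : 0 ≤ a := hX.posSemidef.re_dotProduct_nonneg x
    have hb0 : 0 ≤ b := hY.posSemidef.re_dotProduct_nonneg x
    have hlim : Filter.Tendsto (fun ε : ℝ => ((n : ℝ) - 1) * ε ^ α + (ε + b) ^ α)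
        (nhdsWithin 0 (Set.Ioi 0)) (nhds (((n : ℝ) - 1) * 0 ^ α + (0 + b) ^ α)) := by
      have hc : Continuous fun t : ℝ => t ^ α := Real.continuous_rpow_const hα.le
      exact (((hc.const_mul _).add
        (hc.comp (continuous_id.add continuous_const))).tendsto 0).mono_left nhdsWithin_le_nhds
    have hle := ge_of_tendsto hlim (Filter.eventually_of_mem self_mem_nhdsWithin key)
    have hab : a ≤ b := by
      simp only [zero_add, add_le_add_iff_left] at hle
      exact (Real.rpow_le_rpow_iff ha0 hb0 hα).mp hle
    rw [sub_mulVec, dotProduct_sub, sub_nonneg, Complex.le_def]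
    refine ⟨hab, ?_⟩
    rw [← (Complex.le_def.mp (hX.posSemidef.dotProduct_mulVec_nonneg x)).2,
      ← (Complex.le_def.mp (hY.posSemidef.dotProduct_mulVec_nonneg x)).2]

lemma DalphaPD_rpowMat {X : Matrix (Fin n) (Fin n) ℂ} (hX : X.PosDef) {α : ℝ} (h0 : α ≠ 0)
    (h1 : α ≠ 1) (A : Matrix (Fin n) (Fin n) ℂ) :
    DalphaPD α A (rpowMat X (α / (1 - α))) = (α - 1)⁻¹ * Real.log ((retr A)⁻¹ *
      retr (rpowMat (rpowMat X (1 / 2) * A * rpowMat X (1 / 2)) α)) := by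
  have : 1 - α ≠ 0 := sub_ne_zero.mpr h1.symm
  rw [DalphaPD, rpowMat_rpowMat hX, show α / (1 - α) * ((1 - α) / (2 * α)) = 1 / 2 by field_simp]

lemma retr_pos [NeZero n] (hA : A.PosDef) : 0 < retr A := by
  simpa [rpowMat_one hA] using retr_rpowMat_pos hA 1

end RealPowers

/-- If a bijection `φ` of the positive definite cone preserves `D_α`,
then `ψ(X) = (φ(X^{α/(1−α)}))^{(1−α)/α}` is a bijective order automorphism of the cone
with respect to the Loewner order. -/
theorem stmt19 {n : ℕ} (α : ℝ) (hα : α ∈ Set.Ioo (0:ℝ) 1 ∪ Set.Ioi (1:ℝ))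
    (φ : Matrix (Fin n) (Fin n) ℂ → Matrix (Fin n) (Fin n) ℂ)
    (hbij : Set.BijOn φ {A : Matrix (Fin n) (Fin n) ℂ | A.PosDef}
      {A : Matrix (Fin n) (Fin n) ℂ | A.PosDef})
    (hφ : ∀ A B : Matrix (Fin n) (Fin n) ℂ, A.PosDef → B.PosDef →
      DalphaPD α (φ A) (φ B) = DalphaPD α A B) :
    Set.BijOn (fun X => rpowMat (φ (rpowMat X (α / (1 - α)))) ((1 - α) / α))
      {A : Matrix (Fin n) (Fin n) ℂ | A.PosDef}
      {A : Matrix (Fin n) (Fin n) ℂ | A.PosDef} ∧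
    ∀ X Y : Matrix (Fin n) (Fin n) ℂ, X.PosDef → Y.PosDef →
      ((Y - X).PosSemidef ↔
        (rpowMat (φ (rpowMat Y (α / (1 - α)))) ((1 - α) / α) -
          rpowMat (φ (rpowMat X (α / (1 - α)))) ((1 - α) / α)).PosSemidef) := by
  have h0 : 0 < α := hα.elim (fun h => h.1) fun h => zero_lt_one.trans h
  have h1 : α ≠ 1 := hα.elim (fun h => h.2.ne) fun h => (Set.mem_Ioi.mp h).ne'
  have h1' : 1 - α ≠ 0 := sub_ne_zero.mpr h1.symm
  have hpq : α / (1 - α) * ((1 - α) / α) = 1 := by field_simp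
  have hqp : (1 - α) / α * (α / (1 - α)) = 1 := by field_simp
  have hpow {p q : ℝ} (h₁ : p * q = 1) (h₂ : q * p = 1) :
      Set.BijOn (fun A : Matrix (Fin n) (Fin n) ℂ => rpowMat A p)
        {A | A.PosDef} {A | A.PosDef} := by
    refine Set.InvOn.bijOn (f' := fun A => rpowMat A q) ⟨fun A hA => ?_, fun A hA => ?_⟩
      (fun A hA => hA.rpowMat p) (fun A hA => hA.rpowMat q)
    · simp only [rpowMat_rpowMat hA, h₁, rpowMat_one hA]
    · simp only [rpowMat_rpowMat hA, h₂, rpowMat_one hA]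
  refine ⟨(hpow hqp hpq).comp (hbij.comp (hpow hpq hqp)), fun X Y hX hY => ?_⟩
  rcases Nat.eq_zero_or_pos n with rfl | hn
  · exact iff_of_eq (congrArg _ (Subsingleton.elim _ _))
  have : NeZero n := ⟨hn.ne'⟩
  have hφX {Z : Matrix (Fin n) (Fin n) ℂ} (hZ : Z.PosDef) : (φ (rpowMat Z (α / (1 - α)))).PosDef :=
    hbij.mapsTo (hZ.rpowMat _)
  have hT {Z A : Matrix (Fin n) (Fin n) ℂ} (hZ : Z.PosDef) (hA : A.PosDef) :
      0 < (retr A)⁻¹ * retr (rpowMat (rpowMat Z (1 / 2) * A * rpowMat Z (1 / 2)) α) :=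
    mul_pos (inv_pos.mpr (retr_pos hA)) (retr_rpowMat_pos (hA.mul_mul_same (hZ.rpowMat _)) α)
  have key {Z A : Matrix (Fin n) (Fin n) ℂ} (hZ : Z.PosDef) (hA : A.PosDef) :
      (retr (φ A))⁻¹ * retr (rpowMat (rpowMat
        (rpowMat (φ (rpowMat Z (α / (1 - α)))) ((1 - α) / α)) (1 / 2) * φ A * rpowMat
          (rpowMat (φ (rpowMat Z (α / (1 - α)))) ((1 - α) / α)) (1 / 2)) α) =
        (retr A)⁻¹ * retr (rpowMat (rpowMat Z (1 / 2) * A * rpowMat Z (1 / 2)) α) := by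
    have hψ := (hφX hZ).rpowMat ((1 - α) / α)
    have h := hφ A _ hA (hZ.rpowMat (α / (1 - α)))
    have hφψ := rpowMat_rpowMat (hφX hZ) ((1 - α) / α) (α / (1 - α))
    rw [hqp, rpowMat_one (hφX hZ)] at hφψ
    rw [DalphaPD_rpowMat hZ h0.ne' h1, ← hφψ, DalphaPD_rpowMat hψ h0.ne' h1] at h
    exact Real.log_injOn_pos (hT hψ (hbij.mapsTo hA)) (hT hZ hA)
      (mul_left_cancel₀ (inv_ne_zero (sub_ne_zero.mpr h1)) h)
  rw [posSemidef_sub_iff_forall_retr_le hX hY h0, posSemidef_sub_iff_forall_retr_le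
    ((hφX hX).rpowMat _) ((hφX hY).rpowMat _) h0]
  have hcmp {A : Matrix (Fin n) (Fin n) ℂ} (hA : A.PosDef) {s t : ℝ} :
      (retr A)⁻¹ * s ≤ (retr A)⁻¹ * t ↔ s ≤ t :=
    mul_le_mul_iff_right₀ (inv_pos.mpr (retr_pos hA))
  constructor
  · intro h A' hA'
    obtain ⟨A, hA, rfl⟩ := hbij.surjOn hA'
    rw [← hcmp hA', key hX hA, key hY hA, hcmp hA]
    exact h A hA
  · intro h A hA
    rw [← hcmp hA, ← key hX hA, ← key hY hA, hcmp (hbij.mapsTo hA)]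
    exact h _ (hbij.mapsTo hA)
end
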